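/- arXiv:1912.09625 — 11 statements merged into one kernel-verified Lean document; each statement's English description precedes it below -/
import Mathlib

section
/- Let s = (s₁,s₂) : [0,T] → ℝ² be a solution of the slowdown vector field with s₁(t) > 0 and s₂(t) > 0 and s₁(t)² + s₂(t)² ≤ r̃₀² for all t ∈ [0,T]. If s₁(0)·s₂(0) ≥ (1/2)·r̃₁², then T ≤ (4·r₀^{2p} − r₁^{2p}) / (2·r₁^{3p−2}·log λ). -/
open Real Set

/-- A function on `(0, ∞)` that is smooth with nonnegative derivative is monotone there. -/
theorem monotoneOn_Ioi_of_contDiffOn_of_deriv_nonneg {Ψ : ℝ → ℝ}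
    (hΨ : ContDiffOn ℝ (⊤ : ℕ∞) Ψ (Set.Ioi 0)) (hΨ' : ∀ u : ℝ, 0 < u → 0 ≤ deriv Ψ u) :
    MonotoneOn Ψ (Set.Ioi 0) := by
  refine monotoneOn_of_deriv_nonneg (convex_Ioi 0) hΨ.continuousOn ?_ ?_
  · rw [interior_Ioi]
    exact hΨ.differentiableOn (by simp)
  · rw [interior_Ioi]
    exact fun u hu => hΨ' u hu

/-- Square of the rescaled radius `(2/p) r^{p/2}`. -/
theorem sq_rescaled_radius (p : ℕ) {r : ℝ} (hr : 0 < r) :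
    ((2 / (p : ℝ)) * r ^ ((p : ℝ) / 2)) ^ 2 = (2 / (p : ℝ)) ^ 2 * r ^ p := by
  rw [mul_pow, ← Real.rpow_natCast (r ^ ((p : ℝ) / 2)) 2, ← Real.rpow_mul hr.le]
  norm_num

/-- The explicit branch of the slow-down function at `((2/p) r^{p/2})²` equals `r^{p-2}`. -/
theorem slowdown_at_sq_rescaled_radius {p : ℕ} (hp : 2 ≤ p) {r : ℝ} (hr : 0 < r) :
    ((p : ℝ) / 2) ^ ((2 * (p : ℝ) - 4) / p) *
      (((2 / (p : ℝ)) * r ^ ((p : ℝ) / 2)) ^ 2) ^ (((p : ℝ) - 2) / p) = r ^ (p - 2) := by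
  have hp0 : (0 : ℝ) < p := by exact_mod_cast (by lia : 0 < p)
  have h1 : (2 * (p : ℝ) - 4) / p = (2 : ℕ) * (((p : ℝ) - 2) / p) := by
    push_cast
    ring
  rw [sq_rescaled_radius p hr, h1, Real.rpow_mul (by positivity), Real.rpow_natCast,
    ← Real.mul_rpow (by positivity) (by positivity), ← mul_assoc, ← mul_pow,
    div_mul_div_cancel₀ two_ne_zero, div_self hp0.ne', one_pow, one_mul,
    ← Real.rpow_natCast r p, ← Real.rpow_mul hr.le, mul_div_cancel₀ _ hp0.ne',
    ← Real.rpow_natCast r (p - 2), Nat.cast_sub hp, Nat.cast_two]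

/-- The product of the coordinates is invariant along `s₁' = a s₁`, `s₂' = -a s₂`. -/
theorem mul_eq_of_hasDerivWithinAt_hyperbolic {T : ℝ} {a s1 s2 : ℝ → ℝ}
    (hds1 : ∀ t ∈ Set.Icc (0 : ℝ) T, HasDerivWithinAt s1 (a t * s1 t) (Set.Icc 0 T) t)
    (hds2 : ∀ t ∈ Set.Icc (0 : ℝ) T, HasDerivWithinAt s2 (-(a t * s2 t)) (Set.Icc 0 T) t) :
    ∀ t ∈ Set.Icc (0 : ℝ) T, s1 t * s2 t = s1 0 * s2 0 := by
  have hd : ∀ t ∈ Set.Icc (0 : ℝ) T,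
      HasDerivWithinAt (fun t => s1 t * s2 t) 0 (Set.Icc 0 T) t := fun t ht =>
    ((hds1 t ht).fun_mul (hds2 t ht)).congr_deriv (by ring)
  exact constant_of_derivWithin_zero (fun t ht => (hd t ht).differentiableWithinAt)
    fun t ht => (hd t (Set.Ico_subset_Icc_self ht)).derivWithin
      (uniqueDiffOn_Icc (ht.1.trans_lt ht.2) t (Set.Ico_subset_Icc_self ht))

/-- If `s₁' = a s₁`, `s₂' = -a s₂` with `a ≥ k`, then `log s₁ - log s₂` grows at rate at
least `2k`. -/
theorem two_mul_le_log_sub_log_of_hyperbolic {T k : ℝ} (hT : 0 ≤ T) {a s1 s2 : ℝ → ℝ}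
    (hds1 : ∀ t ∈ Set.Icc (0 : ℝ) T, HasDerivWithinAt s1 (a t * s1 t) (Set.Icc 0 T) t)
    (hds2 : ∀ t ∈ Set.Icc (0 : ℝ) T, HasDerivWithinAt s2 (-(a t * s2 t)) (Set.Icc 0 T) t)
    (hpos1 : ∀ t ∈ Set.Icc (0 : ℝ) T, 0 < s1 t)
    (hpos2 : ∀ t ∈ Set.Icc (0 : ℝ) T, 0 < s2 t)
    (ha : ∀ t ∈ Set.Icc (0 : ℝ) T, k ≤ a t) :
    2 * k * T ≤ (Real.log (s1 T) - Real.log (s2 T)) - (Real.log (s1 0) - Real.log (s2 0)) := by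
  have hd : ∀ t ∈ Set.Icc (0 : ℝ) T,
      HasDerivWithinAt (fun t => Real.log (s1 t) - Real.log (s2 t) - 2 * k * t)
        (2 * (a t - k)) (Set.Icc 0 T) t := fun t ht => by
    have h1 := (hpos1 t ht).ne'
    have h2 := (hpos2 t ht).ne'
    refine ((((hds1 t ht).log h1).fun_sub ((hds2 t ht).log h2)).fun_sub
      ((hasDerivWithinAt_id t _).const_mul (2 * k))).congr_deriv ?_
    field_simp
    ring
  have hmono : MonotoneOn (fun t => Real.log (s1 t) - Real.log (s2 t) - 2 * k * t)
      (Set.Icc 0 T) :=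
    monotoneOn_of_hasDerivWithinAt_nonneg (convex_Icc 0 T)
      (fun t ht => (hd t ht).continuousWithinAt)
      (fun t ht => (hd t (interior_subset ht)).mono interior_subset)
      fun t ht => by linarith [ha t (interior_subset ht)]
  have h := hmono (Set.left_mem_Icc.2 hT) (Set.right_mem_Icc.2 hT) hT
  simp only [mul_zero] at h
  linarith

/-- If `x ≤ M y` for positive `x, y`, then `log x - log y ≤ M - 1`. -/
theorem log_sub_log_le_sub_one {x y M : ℝ} (hx : 0 < x) (hy : 0 < y) (h : x ≤ M * y) :
    Real.log x - Real.log y ≤ M - 1 := by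
  rw [← Real.log_div hx.ne' hy.ne']
  linarith [Real.log_le_sub_one_of_pos (div_pos hx hy), (div_le_iff₀ hy).2 h]

/-- If `s = (s₁,s₂)` is a positive solution of the slowdown vector field
staying in the disc `D_{r̃₀}` on `[0,T]` and `s₁(0)·s₂(0) ≥ (1/2)·r̃₁²`, then
`T ≤ (4·r₀^{2p} − r₁^{2p}) / (2·r₁^{3p−2}·log λ)`. -/
theorem exit_time_bound_case1
    (p : ℕ) (hp : 3 ≤ p) (lam : ℝ) (hlam : 1 < lam)
    (r0 r1 : ℝ) (hr1 : 0 < r1) (hr01 : r1 < r0)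
    (rt0 rt1 : ℝ)
    (hrt0 : rt0 = (2 / (p : ℝ)) * r0 ^ ((p : ℝ) / 2))
    (hrt1 : rt1 = (2 / (p : ℝ)) * r1 ^ ((p : ℝ) / 2))
    (Ψ : ℝ → ℝ)
    (hΨ1 : ∀ u ∈ Set.Icc (0 : ℝ) (rt1 ^ 2),
      Ψ u = ((p : ℝ) / 2) ^ ((2 * (p : ℝ) - 4) / p) * u ^ (((p : ℝ) - 2) / p))
    (hΨ2 : ContDiffOn ℝ (⊤ : ℕ∞) Ψ (Set.Ioi 0))
    (hΨ3 : ∀ u : ℝ, 0 < u → 0 ≤ deriv Ψ u)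
    (hΨ4 : ∀ u : ℝ, rt0 ^ 2 ≤ u → Ψ u = 1)
    (T : ℝ) (hT : 0 ≤ T) (s1 s2 : ℝ → ℝ)
    (hds1 : ∀ t ∈ Set.Icc (0 : ℝ) T, HasDerivWithinAt s1
      (Real.log lam * s1 t * Ψ (s1 t ^ 2 + s2 t ^ 2)) (Set.Icc 0 T) t)
    (hds2 : ∀ t ∈ Set.Icc (0 : ℝ) T, HasDerivWithinAt s2
      (-(Real.log lam * s2 t * Ψ (s1 t ^ 2 + s2 t ^ 2))) (Set.Icc 0 T) t)
    (hpos1 : ∀ t ∈ Set.Icc (0 : ℝ) T, 0 < s1 t)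
    (hpos2 : ∀ t ∈ Set.Icc (0 : ℝ) T, 0 < s2 t)
    (hdisc : ∀ t ∈ Set.Icc (0 : ℝ) T, s1 t ^ 2 + s2 t ^ 2 ≤ rt0 ^ 2)
    (hinit : (1 / 2) * rt1 ^ 2 ≤ s1 0 * s2 0) :
    T ≤ (4 * r0 ^ (2 * p) - r1 ^ (2 * p)) / (2 * r1 ^ (3 * p - 2) * Real.log lam) := by
  have hp0 : (0 : ℝ) < p := by exact_mod_cast (by lia : 0 < p)
  have hr0 : 0 < r0 := hr1.trans hr01
  have hL : 0 < Real.log lam := Real.log_pos hlam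
  have hrt1pos : 0 < rt1 ^ 2 := by rw [hrt1]; positivity
  set R : ℝ := r0 ^ p / r1 ^ p with hR
  have hrt : rt0 ^ 2 = R * rt1 ^ 2 := by
    rw [hrt0, hrt1, sq_rescaled_radius p hr0, sq_rescaled_radius p hr1, hR]
    field_simp
  have hΨrt1 : Ψ (rt1 ^ 2) = r1 ^ (p - 2) := by
    rw [hΨ1 _ (Set.right_mem_Icc.2 hrt1pos.le), hrt1]
    exact slowdown_at_sq_rescaled_radius (by lia) hr1
  have hΨmono := monotoneOn_Ioi_of_contDiffOn_of_deriv_nonneg hΨ2 hΨ3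
  have hds1' : ∀ t ∈ Set.Icc (0 : ℝ) T, HasDerivWithinAt s1
      (Real.log lam * Ψ (s1 t ^ 2 + s2 t ^ 2) * s1 t) (Set.Icc 0 T) t :=
    fun t ht => (hds1 t ht).congr_deriv (by ring)
  have hds2' : ∀ t ∈ Set.Icc (0 : ℝ) T, HasDerivWithinAt s2
      (-(Real.log lam * Ψ (s1 t ^ 2 + s2 t ^ 2) * s2 t)) (Set.Icc 0 T) t :=
    fun t ht => (hds2 t ht).congr_deriv (by ring)
  have hprod : ∀ t ∈ Set.Icc (0 : ℝ) T, 1 / 2 * rt1 ^ 2 ≤ s1 t * s2 t := fun t ht =>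
    hinit.trans_eq (mul_eq_of_hasDerivWithinAt_hyperbolic hds1' hds2' t ht).symm
  have hspeed : ∀ t ∈ Set.Icc (0 : ℝ) T,
      Real.log lam * r1 ^ (p - 2) ≤ Real.log lam * Ψ (s1 t ^ 2 + s2 t ^ 2) := fun t ht => by
    have hu : rt1 ^ 2 ≤ s1 t ^ 2 + s2 t ^ 2 := by
      linarith [hprod t ht, two_mul_le_add_sq (s1 t) (s2 t)]
    rw [← hΨrt1]
    exact mul_le_mul_of_nonneg_left (hΨmono hrt1pos (hrt1pos.trans_le hu) hu) hL.le
  have hgrowth := two_mul_le_log_sub_log_of_hyperbolic hT hds1' hds2' hpos1 hpos2 hspeed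
  have hRpos : 0 < R := by positivity
  have hbound : ∀ t ∈ Set.Icc (0 : ℝ) T, rt0 ^ 2 ≤ 2 * R * (s1 t * s2 t) := fun t ht => by
    rw [hrt]
    linarith [mul_le_mul_of_nonneg_left (hprod t ht) hRpos.le]
  have hTmem : T ∈ Set.Icc (0 : ℝ) T := Set.right_mem_Icc.2 hT
  have h0mem : (0 : ℝ) ∈ Set.Icc (0 : ℝ) T := Set.left_mem_Icc.2 hT
  have hend : s1 T ≤ 2 * R * s2 T := by
    refine le_of_mul_le_mul_left ?_ (hpos1 T hTmem)
    nlinarith [hbound T hTmem, hdisc T hTmem, sq_nonneg (s2 T)]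
  have hstart : s2 0 ≤ 2 * R * s1 0 := by
    refine le_of_mul_le_mul_left ?_ (hpos2 0 h0mem)
    nlinarith [hbound 0 h0mem, hdisc 0 h0mem, sq_nonneg (s1 0)]
  have hlogT := log_sub_log_le_sub_one (hpos1 T hTmem) (hpos2 T hTmem) hend
  have hlog0 := log_sub_log_le_sub_one (hpos2 0 h0mem) (hpos1 0 h0mem) hstart
  have hmain : 2 * (Real.log lam * r1 ^ (p - 2)) * T ≤ 4 * R ^ 2 - 1 := by
    linarith [sq_nonneg (2 * R - 1)]
  have hr0p : r0 ^ (2 * p) = R ^ 2 * r1 ^ (2 * p) := by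
    rw [hR, pow_mul', pow_mul', ← mul_pow, div_mul_cancel₀ _ (pow_pos hr1 p).ne']
  have hexp : r1 ^ (3 * p - 2) = r1 ^ (p - 2) * r1 ^ (2 * p) := by
    rw [← pow_add]
    congr 1
    lia
  rw [le_div_iff₀ (by positivity), hr0p, hexp]
  linarith [mul_le_mul_of_nonneg_right hmain (pow_pos hr1 (2 * p)).le]
end

section
/- Let s = (s₁,s₂) : [0,T] → ℝ² be a solution of the slowdown vector field with s₂(t) > 0 and s₁(t)² + s₂(t)² ≤ r̃₀² for all t ∈ [0,T]. If s₂(t)² ≥ (1/2)·r̃₁² for all t ∈ [0,T], then T ≤ 2^{(p−2)/2}·(2·r₀^{p} − r₁^{p}) / (2·r₁^{2p−2}·log λ). -/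
open Real Set

/-- A function that is differentiable on `(0, ∞)` with nonnegative derivative is monotone there. -/
theorem monotoneOn_Ioi_of_deriv_nonneg {f : ℝ → ℝ} (hf : DifferentiableOn ℝ f (Set.Ioi 0))
    (hf' : ∀ u : ℝ, 0 < u → 0 ≤ deriv f u) : MonotoneOn f (Set.Ioi 0) :=
  monotoneOn_of_deriv_nonneg (convex_Ioi 0) hf.continuousOn (by simpa using hf)
    (by simpa using hf')

/-- If `y' = -(y g)` on `[0,T]` with `m ≤ y²`, `c ≤ g` and `0 ≤ c`, then `y²`
decreases at rate at least `2 m c`. -/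
theorem sq_add_mul_le_sq_of_decay {y g : ℝ → ℝ} {T m c : ℝ} (hT : 0 ≤ T) (hc : 0 ≤ c)
    (hy : ∀ t ∈ Set.Icc 0 T, HasDerivWithinAt y (-(y t * g t)) (Set.Icc 0 T) t)
    (hym : ∀ t ∈ Set.Icc 0 T, m ≤ y t ^ 2) (hg : ∀ t ∈ Set.Icc 0 T, c ≤ g t) :
    y T ^ 2 + 2 * m * c * T ≤ y 0 ^ 2 := by
  have hd : ∀ t ∈ Set.Icc 0 T, HasDerivWithinAt (fun t => y t ^ 2 + 2 * m * c * t)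
      (2 * (m * c - y t ^ 2 * g t)) (Set.Icc 0 T) t := fun t ht => by
    have h := ((hy t ht).fun_pow 2).add ((hasDerivWithinAt_id t (Set.Icc 0 T)).const_mul (2 * m * c))
    refine h.congr_deriv ?_
    norm_num
    ring
  have hanti : AntitoneOn (fun t => y t ^ 2 + 2 * m * c * t) (Set.Icc 0 T) := by
    refine antitoneOn_of_hasDerivWithinAt_nonpos (convex_Icc 0 T)
      (fun t ht => (hd t ht).continuousWithinAt)
      (fun t ht => (hd t (interior_subset ht)).mono interior_subset) fun t ht => ?_
    have ht := interior_subset ht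
    have : m * c ≤ y t ^ 2 * g t :=
      mul_le_mul (hym t ht) (hg t ht) hc (sq_nonneg _)
    linarith
  simpa using hanti (left_mem_Icc.2 hT) (right_mem_Icc.2 hT) hT

/-- The square of `(2/p) r^{p/2}`. -/
theorem sq_two_div_mul_rpow_half (p : ℕ) {r : ℝ} (hr : 0 ≤ r) :
    ((2 / (p : ℝ)) * r ^ ((p : ℝ) / 2)) ^ 2 = (2 / (p : ℝ)) ^ 2 * r ^ p := by
  rw [mul_pow, ← Real.rpow_natCast (r ^ ((p : ℝ) / 2)) 2, ← Real.rpow_mul hr,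
    ← Real.rpow_natCast r p]
  congr 2
  push_cast
  ring

/-- The slow-down profile at half the squared radius `(2/p)² r^p`. -/
theorem slowdown_profile_half {p : ℕ} (hp : 3 ≤ p) {r : ℝ} (hr : 0 < r) :
    ((p : ℝ) / 2) ^ ((2 * (p : ℝ) - 4) / p) *
        (1 / 2 * ((2 / (p : ℝ)) ^ 2 * r ^ p)) ^ (((p : ℝ) - 2) / p) *
        (2 : ℝ) ^ (((p : ℝ) - 2) / p) = r ^ (p - 2) := by
  have hp0 : (0 : ℝ) < p := by positivity
  have hsq : ((p : ℝ) / 2) ^ ((2 * (p : ℝ) - 4) / p) =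
      (((p : ℝ) / 2) ^ 2) ^ (((p : ℝ) - 2) / p) := by
    rw [← Real.rpow_natCast _ 2, ← Real.rpow_mul (by positivity)]
    congr 1
    push_cast
    ring
  rw [hsq, ← Real.mul_rpow (by positivity) (by positivity),
    ← Real.mul_rpow (by positivity) (by positivity)]
  have hbase : ((p : ℝ) / 2) ^ 2 * (1 / 2 * ((2 / (p : ℝ)) ^ 2 * r ^ p)) * 2 = r ^ p := by
    field_simp
  rw [hbase, ← Real.rpow_natCast r p, ← Real.rpow_mul hr.le, ← Real.rpow_natCast r (p - 2),
    Nat.cast_sub (by lia)]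
  congr 1
  push_cast
  field_simp

/-- If `s = (s₁,s₂)` is a solution of the slowdown vector field on `[0,T]`
with `s₂ > 0`, staying in the disc `D_{r̃₀}`, and `s₂(t)² ≥ (1/2)·r̃₁²` throughout, then
`T ≤ 2^{(p−2)/2}·(2·r₀^{p} − r₁^{p}) / (2·r₁^{2p−2}·log λ)`. -/
theorem exit_time_bound_case2
    (p : ℕ) (hp : 3 ≤ p) (lam : ℝ) (hlam : 1 < lam)
    (r0 r1 : ℝ) (hr1 : 0 < r1) (hr01 : r1 < r0)
    (rt0 rt1 : ℝ)
    (hrt0 : rt0 = (2 / (p : ℝ)) * r0 ^ ((p : ℝ) / 2))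
    (hrt1 : rt1 = (2 / (p : ℝ)) * r1 ^ ((p : ℝ) / 2))
    (Ψ : ℝ → ℝ)
    (hΨ1 : ∀ u ∈ Set.Icc (0 : ℝ) (rt1 ^ 2),
      Ψ u = ((p : ℝ) / 2) ^ ((2 * (p : ℝ) - 4) / p) * u ^ (((p : ℝ) - 2) / p))
    (hΨ2 : ContDiffOn ℝ (⊤ : ℕ∞) Ψ (Set.Ioi 0))
    (hΨ3 : ∀ u : ℝ, 0 < u → 0 ≤ deriv Ψ u)
    (hΨ4 : ∀ u : ℝ, rt0 ^ 2 ≤ u → Ψ u = 1)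
    (T : ℝ) (hT : 0 ≤ T) (s1 s2 : ℝ → ℝ)
    (hds1 : ∀ t ∈ Set.Icc (0 : ℝ) T, HasDerivWithinAt s1
      (Real.log lam * s1 t * Ψ (s1 t ^ 2 + s2 t ^ 2)) (Set.Icc 0 T) t)
    (hds2 : ∀ t ∈ Set.Icc (0 : ℝ) T, HasDerivWithinAt s2
      (-(Real.log lam * s2 t * Ψ (s1 t ^ 2 + s2 t ^ 2))) (Set.Icc 0 T) t)
    (hpos2 : ∀ t ∈ Set.Icc (0 : ℝ) T, 0 < s2 t)
    (hdisc : ∀ t ∈ Set.Icc (0 : ℝ) T, s1 t ^ 2 + s2 t ^ 2 ≤ rt0 ^ 2)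
    (hbig : ∀ t ∈ Set.Icc (0 : ℝ) T, (1 / 2) * rt1 ^ 2 ≤ s2 t ^ 2) :
    T ≤ (2 : ℝ) ^ (((p : ℝ) - 2) / 2) * (2 * r0 ^ p - r1 ^ p) /
      (2 * r1 ^ (2 * p - 2) * Real.log lam) := by
  have hp0 : (3 : ℝ) ≤ p := by exact_mod_cast hp
  have hlog : 0 < Real.log lam := Real.log_pos hlam
  have hsq0 : rt0 ^ 2 = (2 / (p : ℝ)) ^ 2 * r0 ^ p := by
    rw [hrt0, sq_two_div_mul_rpow_half p (hr1.trans hr01).le]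
  have hsq1 : rt1 ^ 2 = (2 / (p : ℝ)) ^ 2 * r1 ^ p := by
    rw [hrt1, sq_two_div_mul_rpow_half p hr1.le]
  have hrt1_pos : 0 < rt1 ^ 2 := by rw [hsq1]; positivity
  have hmono := monotoneOn_Ioi_of_deriv_nonneg (hΨ2.differentiableOn (by simp)) hΨ3
  set k : ℝ := (2 : ℝ) ^ (((p : ℝ) - 2) / p)
  set c : ℝ := Ψ (1 / 2 * rt1 ^ 2)
  have hck : c * k = r1 ^ (p - 2) := by
    rw [← slowdown_profile_half hp hr1, ← hsq1,
      ← hΨ1 (1 / 2 * rt1 ^ 2) ⟨by positivity, by linarith⟩]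
  have hk : 0 < k := by positivity
  have hkK : k ≤ (2 : ℝ) ^ (((p : ℝ) - 2) / 2) :=
    Real.rpow_le_rpow_of_exponent_le one_le_two
      (div_le_div_of_nonneg_left (by linarith) two_pos (by linarith))
  have hc : 0 < c := pos_of_mul_pos_left (hck ▸ by positivity) hk.le
  have hdecay := sq_add_mul_le_sq_of_decay (y := s2)
    (g := fun t => Real.log lam * Ψ (s1 t ^ 2 + s2 t ^ 2)) (m := 1 / 2 * rt1 ^ 2)
    (c := Real.log lam * c) hT (by positivity)
    (fun t ht => (hds2 t ht).congr_deriv (by ring)) hbig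
    (fun t ht => by
      have hle : 1 / 2 * rt1 ^ 2 ≤ s1 t ^ 2 + s2 t ^ 2 := by
        linarith [hbig t ht, sq_nonneg (s1 t)]
      have hpos : 0 < 1 / 2 * rt1 ^ 2 := by positivity
      exact mul_le_mul_of_nonneg_left (hmono hpos (hpos.trans_le hle) hle) hlog.le)
  have hstart := hdisc 0 (left_mem_Icc.2 hT)
  have hend := hbig T (right_mem_Icc.2 hT)
  have hmain : rt1 ^ 2 * (Real.log lam * c) * T ≤ rt0 ^ 2 - 1 / 2 * rt1 ^ 2 := by
    linarith [sq_nonneg (s1 0)]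
  have hmain' : 2 * r1 ^ p * (Real.log lam * c) * T ≤ 2 * r0 ^ p - r1 ^ p := by
    rw [hsq0, hsq1] at hmain
    have hq : 0 < (2 / (p : ℝ)) ^ 2 := by positivity
    refine le_of_mul_le_mul_left ?_ hq
    linarith
  have hexp : r1 ^ (2 * p - 2) = r1 ^ p * (c * k) := by
    rw [hck, ← pow_add]
    congr 1
    lia
  have hgap : 0 ≤ 2 * r0 ^ p - r1 ^ p := le_trans (by positivity) hmain'
  rw [le_div_iff₀ (by positivity)]
  calc T * (2 * r1 ^ (2 * p - 2) * Real.log lam)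
      = k * (2 * r1 ^ p * (Real.log lam * c) * T) := by rw [hexp]; ring
    _ ≤ k * (2 * r0 ^ p - r1 ^ p) := mul_le_mul_of_nonneg_left hmain' hk.le
    _ ≤ _ := mul_le_mul_of_nonneg_right hkK hgap
end

section
/- Define F : ℝ² → ℝ by F(s₁,s₂) = s₂·(p/2)^{(2p−4)/p}·(s₁²+s₂²)^{(p−2)/p}, and for i,j ∈ {1,2} let d_{ij}(s₁,s₂) = ∂²F/∂s_i∂s_j(s₁,s₂). Then for every (s₁,s₂) ≠ (0,0) with s₁²+s₂² ≤ r̃₁², one has max over i,j ∈ {1,2} of |d_{ij}(s₁,s₂)| ≤ ((6p−12)/p)·(p/2)^{(2p−4)/p}·(s₁²+s₂²)^{(p−4)/(2p)}. -/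
open Real Set

/-- Partial derivative of `(x² + y²)^b` in the first variable, away from the origin. -/
lemma hasDerivAt_sq_add_rpow {x y : ℝ} (h : x ^ 2 + y ^ 2 ≠ 0) (b : ℝ) :
    HasDerivAt (fun t : ℝ => (t ^ 2 + y ^ 2) ^ b) (2 * b * x * (x ^ 2 + y ^ 2) ^ (b - 1)) x := by
  have h1 : HasDerivAt (fun t : ℝ => t ^ 2 + y ^ 2) (2 * x) x := by
    simpa using (hasDerivAt_pow 2 x).add_const (y ^ 2)
  convert h1.rpow_const (p := b) (Or.inl h) using 1
  ring

/-- Partial derivative of `(x² + y²)^b` in the second variable, away from the origin. -/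
lemma hasDerivAt_add_sq_rpow {x y : ℝ} (h : x ^ 2 + y ^ 2 ≠ 0) (b : ℝ) :
    HasDerivAt (fun t : ℝ => (x ^ 2 + t ^ 2) ^ b) (2 * b * y * (x ^ 2 + y ^ 2) ^ (b - 1)) y := by
  simpa only [add_comm] using hasDerivAt_sq_add_rpow (x := y) (y := x) (by rwa [add_comm]) b

lemma eventually_sq_add_ne_zero {x y : ℝ} (h : x ^ 2 + y ^ 2 ≠ 0) :
    ∀ᶠ t in nhds x, t ^ 2 + y ^ 2 ≠ 0 :=
  ContinuousAt.eventually_ne (g := fun t : ℝ => t ^ 2 + y ^ 2) (by fun_prop) h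

lemma eventually_add_sq_ne_zero {x y : ℝ} (h : x ^ 2 + y ^ 2 ≠ 0) :
    ∀ᶠ t in nhds y, x ^ 2 + t ^ 2 ≠ 0 :=
  ContinuousAt.eventually_ne (g := fun t : ℝ => x ^ 2 + t ^ 2) (by fun_prop) h

section PartialDerivatives

variable {x y : ℝ} (C a : ℝ)

lemma deriv_fst_mul_rpow (h : x ^ 2 + y ^ 2 ≠ 0) :
    deriv (fun t : ℝ => y * C * (t ^ 2 + y ^ 2) ^ a) x =
      2 * a * C * x * y * (x ^ 2 + y ^ 2) ^ (a - 1) := by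
  rw [((hasDerivAt_sq_add_rpow h a).const_mul (y * C)).deriv]
  ring

lemma deriv_snd_mul_rpow (h : x ^ 2 + y ^ 2 ≠ 0) :
    deriv (fun t : ℝ => t * C * (x ^ 2 + t ^ 2) ^ a) y =
      C * (x ^ 2 + y ^ 2) ^ a + 2 * a * C * y ^ 2 * (x ^ 2 + y ^ 2) ^ (a - 1) := by
  refine (((hasDerivAt_id y).mul_const C).mul (hasDerivAt_add_sq_rpow h a)).deriv.trans ?_
  simp only [id]
  ring

lemma deriv_fst_fst_mul_rpow (h : x ^ 2 + y ^ 2 ≠ 0) :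
    deriv (fun s : ℝ => deriv (fun t : ℝ => y * C * (t ^ 2 + y ^ 2) ^ a) s) x =
      2 * a * C * y * (x ^ 2 + y ^ 2) ^ (a - 2) *
        (1 * (x ^ 2 + y ^ 2) + 2 * (a - 1) * x ^ 2) := by
  have he := (eventually_sq_add_ne_zero h).mono fun t ht => deriv_fst_mul_rpow (y := y) C a ht
  have hd := (((hasDerivAt_id x).const_mul (2 * a * C)).mul_const y).mul
    (hasDerivAt_sq_add_rpow h (a - 1))
  rw [Filter.EventuallyEq.deriv_eq he]
  refine hd.deriv.trans ?_
  rw [show a - 1 = a - 2 + 1 by ring, rpow_add_one h, add_sub_cancel_right]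
  simp only [id]
  ring

lemma deriv_fst_snd_mul_rpow (h : x ^ 2 + y ^ 2 ≠ 0) :
    deriv (fun s : ℝ => deriv (fun t : ℝ => t * C * (s ^ 2 + t ^ 2) ^ a) y) x =
      2 * a * C * x * (x ^ 2 + y ^ 2) ^ (a - 2) *
        (1 * (x ^ 2 + y ^ 2) + 2 * (a - 1) * y ^ 2) := by
  have he := (eventually_sq_add_ne_zero h).mono fun t ht => deriv_snd_mul_rpow (y := y) C a ht
  have hd := ((hasDerivAt_sq_add_rpow h a).const_mul C).add
    ((hasDerivAt_sq_add_rpow h (a - 1)).const_mul (2 * a * C * y ^ 2))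
  rw [Filter.EventuallyEq.deriv_eq he]
  refine hd.deriv.trans ?_
  rw [show a - 1 = a - 2 + 1 by ring, rpow_add_one h, add_sub_cancel_right]
  ring

lemma deriv_snd_fst_mul_rpow (h : x ^ 2 + y ^ 2 ≠ 0) :
    deriv (fun s : ℝ => deriv (fun t : ℝ => s * C * (t ^ 2 + s ^ 2) ^ a) x) y =
      2 * a * C * x * (x ^ 2 + y ^ 2) ^ (a - 2) *
        (1 * (x ^ 2 + y ^ 2) + 2 * (a - 1) * y ^ 2) := by
  have he := (eventually_add_sq_ne_zero h).mono fun t ht => deriv_fst_mul_rpow (x := x) C a ht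
  have hd := ((hasDerivAt_id y).const_mul (2 * a * C * x)).mul
    (hasDerivAt_add_sq_rpow h (a - 1))
  rw [Filter.EventuallyEq.deriv_eq he]
  refine hd.deriv.trans ?_
  rw [show a - 1 = a - 2 + 1 by ring, rpow_add_one h, add_sub_cancel_right]
  simp only [id]
  ring

lemma deriv_snd_snd_mul_rpow (h : x ^ 2 + y ^ 2 ≠ 0) :
    deriv (fun s : ℝ => deriv (fun t : ℝ => t * C * (x ^ 2 + t ^ 2) ^ a) s) y =
      2 * a * C * y * (x ^ 2 + y ^ 2) ^ (a - 2) *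
        (3 * (x ^ 2 + y ^ 2) + 2 * (a - 1) * y ^ 2) := by
  have he := (eventually_add_sq_ne_zero h).mono fun t ht => deriv_snd_mul_rpow (x := x) C a ht
  have hd := ((hasDerivAt_add_sq_rpow h a).const_mul C).add
    (((hasDerivAt_pow 2 y).const_mul (2 * a * C)).mul (hasDerivAt_add_sq_rpow h (a - 1)))
  rw [Filter.EventuallyEq.deriv_eq he]
  refine hd.deriv.trans ?_
  rw [show a - 1 = a - 2 + 1 by ring, rpow_add_one h, add_sub_cancel_right]
  push_cast
  ring

end PartialDerivatives

lemma abs_mul_rpow_mul_le {C a k u v w : ℝ} (hC : 0 ≤ C) (ha : 0 ≤ a) (ha1 : a ≤ 1)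
    (hk : 1 ≤ k) (hk3 : k ≤ 3) (hu : 0 < u) (hv : v ^ 2 ≤ u) (hw : w ^ 2 ≤ u) :
    |2 * a * C * w * u ^ (a - 2) * (k * u + 2 * (a - 1) * v ^ 2)| ≤
      6 * a * C * u ^ (a - 1 / 2) := by
  have h1 : |w| ≤ u ^ (1 / 2 : ℝ) := by
    rw [← sqrt_eq_rpow]
    exact abs_le_sqrt hw
  have h2 : |k * u + 2 * (a - 1) * v ^ 2| ≤ 3 * u := by
    rw [abs_le]
    constructor <;> nlinarith [sq_nonneg v, mul_nonneg (sub_nonneg.2 ha1) (sub_nonneg.2 hv)]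
  have h3 : u ^ (a - 1 / 2) = u ^ (1 / 2 : ℝ) * u ^ (a - 2) * u := by
    rw [← rpow_add hu, ← rpow_add_one hu.ne']
    ring_nf
  have h4 : 0 ≤ u ^ (a - 2) := rpow_nonneg hu.le _
  calc |2 * a * C * w * u ^ (a - 2) * (k * u + 2 * (a - 1) * v ^ 2)|
      = 2 * a * C * |w| * u ^ (a - 2) * |k * u + 2 * (a - 1) * v ^ 2| := by
        simp only [abs_mul, abs_of_nonneg ha, abs_of_nonneg hC, abs_of_nonneg h4, abs_two]
    _ ≤ 2 * a * C * u ^ (1 / 2 : ℝ) * u ^ (a - 2) * (3 * u) := by gcongr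
    _ = 6 * a * C * u ^ (a - 1 / 2) := by
        rw [h3]
        ring

/-- With `F(s₁,s₂) = s₂·(p/2)^{(2p−4)/p}·(s₁²+s₂²)^{(p−2)/p}` and
`d_{ij}` its second partial derivatives, for every `(s₁,s₂) ≠ (0,0)` with
`s₁²+s₂² ≤ r̃₁²` one has
`max_{i,j} |d_{ij}(s₁,s₂)| ≤ ((6p−12)/p)·(p/2)^{(2p−4)/p}·(s₁²+s₂²)^{(p−4)/(2p)}`. -/
theorem dij_estimate
    (p : ℕ) (hp : 3 ≤ p)
    (r0 r1 : ℝ) (hr1 : 0 < r1) (hr01 : r1 < r0)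
    (rt1 : ℝ) (hrt1 : rt1 = (2 / (p : ℝ)) * r1 ^ ((p : ℝ) / 2))
    (F : ℝ → ℝ → ℝ)
    (hF : ∀ x y : ℝ, F x y =
      y * ((p : ℝ) / 2) ^ ((2 * (p : ℝ) - 4) / p) * (x ^ 2 + y ^ 2) ^ (((p : ℝ) - 2) / p))
    (d11 d12 d21 d22 : ℝ → ℝ → ℝ)
    (hd11 : ∀ x y : ℝ, d11 x y = deriv (fun x' => deriv (fun x'' => F x'' y) x') x)
    (hd12 : ∀ x y : ℝ, d12 x y = deriv (fun x' => deriv (fun y' => F x' y') y) x)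
    (hd21 : ∀ x y : ℝ, d21 x y = deriv (fun y' => deriv (fun x' => F x' y') x) y)
    (hd22 : ∀ x y : ℝ, d22 x y = deriv (fun y' => deriv (fun y'' => F x y'') y') y)
    (s1 s2 : ℝ) (hne : (s1, s2) ≠ ((0 : ℝ), (0 : ℝ))) (hin : s1 ^ 2 + s2 ^ 2 ≤ rt1 ^ 2) :
    max (max |d11 s1 s2| |d12 s1 s2|) (max |d21 s1 s2| |d22 s1 s2|) ≤
      ((6 * (p : ℝ) - 12) / p) * ((p : ℝ) / 2) ^ ((2 * (p : ℝ) - 4) / p) *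
        (s1 ^ 2 + s2 ^ 2) ^ (((p : ℝ) - 4) / (2 * p)) := by
  have hp3 : (3 : ℝ) ≤ p := by exact_mod_cast hp
  have hp0 : (0 : ℝ) < p := by linarith
  have hC : 0 ≤ ((p : ℝ) / 2) ^ ((2 * (p : ℝ) - 4) / p) := by positivity
  have ha : 0 ≤ ((p : ℝ) - 2) / p := div_nonneg (by linarith) hp0.le
  have ha1 : ((p : ℝ) - 2) / p ≤ 1 := (div_le_one hp0).2 (by linarith)
  have hu : 0 < s1 ^ 2 + s2 ^ 2 := by
    by_contra! hle
    refine hne (Prod.ext ?_ ?_) <;> dsimp only <;> nlinarith [sq_nonneg s1, sq_nonneg s2]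
  have hx : s1 ^ 2 ≤ s1 ^ 2 + s2 ^ 2 := le_add_of_nonneg_right (sq_nonneg s2)
  have hy : s2 ^ 2 ≤ s1 ^ 2 + s2 ^ 2 := le_add_of_nonneg_left (sq_nonneg s1)
  have hcoef : (6 * (p : ℝ) - 12) / p = 6 * (((p : ℝ) - 2) / p) := by ring
  have hexp : ((p : ℝ) - 4) / (2 * p) = ((p : ℝ) - 2) / p - 1 / 2 := by
    field_simp
    ring
  rw [hcoef, hexp, hd11, hd12, hd21, hd22]
  simp only [hF]
  rw [deriv_fst_fst_mul_rpow _ _ hu.ne', deriv_fst_snd_mul_rpow _ _ hu.ne',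
    deriv_snd_fst_mul_rpow _ _ hu.ne', deriv_snd_snd_mul_rpow _ _ hu.ne']
  refine max_le (max_le ?_ ?_) (max_le ?_ ?_) <;>
    apply abs_mul_rpow_mul_le hC ha ha1 _ _ hu <;> first | assumption | norm_num
end

section
/- Let s = (s₁,s₂) : [0,T] → ℝ² be a solution of the explicit slowdown ODE with s₁(t) > 0, s₂(t) > 0 and s₁(t)²+s₂(t)² ≤ r̃₁² for all t ∈ [0,T]. Then: (a) for all 0 ≤ t ≤ b ≤ T, s₁(t) ≤ s₁(b)·(1 + C₀·s₁(b)^{(2p−4)/p}·(b−t))^{−p/(2p−4)}; and (b) for all 0 ≤ a ≤ t ≤ T, s₂(t) ≤ s₂(a)·(1 + C₀·s₂(a)^{(2p−4)/p}·(t−a))^{−p/(2p−4)}. -/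
open Real Set

/-- Inverting a lower bound on `x ^ (-q)` into an upper bound on `x`. -/
theorem le_mul_one_add_rpow_of_rpow_neg_add_le {x y q D : ℝ} (hx : 0 < x) (hy : 0 < y)
    (hq : 0 < q) (hD : 0 ≤ D) (h : y ^ (-q) + D ≤ x ^ (-q)) :
    x ≤ y * (1 + D * y ^ q) ^ (-q⁻¹) := by
  have hyq : 0 < y ^ q := rpow_pos_of_pos hy q
  have hfac : y ^ (-q) + D = y ^ (-q) * (1 + D * y ^ q) := by
    rw [rpow_neg hy.le]
    field_simp
  have hinv : ∀ z : ℝ, 0 < z → (z ^ (-q)) ^ (-q⁻¹) = z := fun z hz => by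
    rw [← rpow_mul hz.le, neg_mul_neg, mul_inv_cancel₀ hq.ne', rpow_one]
  calc x = (x ^ (-q)) ^ (-q⁻¹) := (hinv x hx).symm
    _ ≤ (y ^ (-q) + D) ^ (-q⁻¹) :=
      rpow_le_rpow_of_nonpos (by positivity) h (neg_nonpos.mpr (inv_pos.mpr hq).le)
    _ = y * (1 + D * y ^ q) ^ (-q⁻¹) := by
      rw [hfac, mul_rpow (by positivity) (by positivity), hinv y hy]

/-- The speed of `x ^ (-q)` along a field of size `k * x * R` with `x ^ q ≤ R`. -/
theorem mul_le_mul_rpow_neg_sub_one {x q k R : ℝ} (hx : 0 < x) (hq : 0 ≤ q) (hk : 0 ≤ k)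
    (hR : x ^ q ≤ R) : q * k ≤ k * x * R * q * x ^ (-q - 1) := by
  have hxq : 0 < x ^ q := rpow_pos_of_pos hx q
  have hpow : x * x ^ (-q - 1) * x ^ q = 1 := by
    rw [rpow_sub_one hx.ne', rpow_neg hx.le]
    field_simp
  calc q * k = q * k * (x * x ^ (-q - 1) * x ^ q) := by rw [hpow, mul_one]
    _ ≤ q * k * (x * x ^ (-q - 1) * R) := by gcongr
    _ = k * x * R * q * x ^ (-q - 1) := by ring

/-- `x ^ (2 * m) ≤ (x ^ 2 + y ^ 2) ^ m` for `0 ≤ x` and `0 ≤ m`. -/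
theorem rpow_two_mul_le_sq_add_sq_rpow {x m : ℝ} (y : ℝ) (hx : 0 ≤ x) (hm : 0 ≤ m) :
    x ^ (2 * m) ≤ (x ^ 2 + y ^ 2) ^ m := by
  rw [rpow_mul hx, rpow_two]
  exact rpow_le_rpow (sq_nonneg x) (le_add_of_nonneg_right (sq_nonneg y)) hm

/-- For a positive solution of the explicit slowdown ODE staying in the disc
`D_{r̃₁}` on `[0,T]`:
(a) `s₁(t) ≤ s₁(b)·(1 + C₀·s₁(b)^{(2p−4)/p}·(b−t))^{−p/(2p−4)}` for `0 ≤ t ≤ b ≤ T`, and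
(b) `s₂(t) ≤ s₂(a)·(1 + C₀·s₂(a)^{(2p−4)/p}·(t−a))^{−p/(2p−4)}` for `0 ≤ a ≤ t ≤ T`. -/
theorem s1_s2_upper_estimates
    (p : ℕ) (hp : 3 ≤ p) (lam : ℝ) (hlam : 1 < lam)
    (r0 r1 : ℝ) (hr1 : 0 < r1) (hr01 : r1 < r0)
    (rt1 : ℝ) (hrt1 : rt1 = (2 / (p : ℝ)) * r1 ^ ((p : ℝ) / 2))
    (C0 : ℝ)
    (hC0 : C0 = ((2 * (p : ℝ) - 4) / p) * ((p : ℝ) / 2) ^ ((2 * (p : ℝ) - 4) / p) *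
      Real.log lam)
    (T : ℝ) (hT : 0 ≤ T) (s1 s2 : ℝ → ℝ)
    (hds1 : ∀ t ∈ Set.Icc (0 : ℝ) T, HasDerivWithinAt s1
      (Real.log lam * ((p : ℝ) / 2) ^ ((2 * (p : ℝ) - 4) / p) * s1 t *
        (s1 t ^ 2 + s2 t ^ 2) ^ (((p : ℝ) - 2) / p)) (Set.Icc 0 T) t)
    (hds2 : ∀ t ∈ Set.Icc (0 : ℝ) T, HasDerivWithinAt s2
      (-(Real.log lam * ((p : ℝ) / 2) ^ ((2 * (p : ℝ) - 4) / p) * s2 t *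
        (s1 t ^ 2 + s2 t ^ 2) ^ (((p : ℝ) - 2) / p))) (Set.Icc 0 T) t)
    (hpos1 : ∀ t ∈ Set.Icc (0 : ℝ) T, 0 < s1 t)
    (hpos2 : ∀ t ∈ Set.Icc (0 : ℝ) T, 0 < s2 t)
    (hdisc : ∀ t ∈ Set.Icc (0 : ℝ) T, s1 t ^ 2 + s2 t ^ 2 ≤ rt1 ^ 2) :
    (∀ t b : ℝ, 0 ≤ t → t ≤ b → b ≤ T →
      s1 t ≤ s1 b *
        (1 + C0 * s1 b ^ ((2 * (p : ℝ) - 4) / p) * (b - t)) ^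
          (-(p : ℝ) / (2 * (p : ℝ) - 4))) ∧
    (∀ a t : ℝ, 0 ≤ a → a ≤ t → t ≤ T →
      s2 t ≤ s2 a *
        (1 + C0 * s2 a ^ ((2 * (p : ℝ) - 4) / p) * (t - a)) ^
          (-(p : ℝ) / (2 * (p : ℝ) - 4))) := by
  have hp' : (3 : ℝ) ≤ p := by exact_mod_cast hp
  have hp0 : (0 : ℝ) < p := by linarith
  set q : ℝ := (2 * (p : ℝ) - 4) / p with hqdef
  set m : ℝ := ((p : ℝ) - 2) / p with hmdef
  set k : ℝ := Real.log lam * ((p : ℝ) / 2) ^ q with hkdef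
  have hq : 0 < q := div_pos (by linarith) hp0
  have hm : 0 ≤ m := div_nonneg (by linarith) hp0.le
  have hqm : q = 2 * m := by rw [hqdef, hmdef]; ring
  have hk : 0 ≤ k := mul_nonneg (Real.log_pos hlam).le (by positivity)
  have hC : C0 = q * k := by rw [hC0, hkdef]; ring
  have hC_nonneg : 0 ≤ C0 := hC ▸ mul_nonneg hq.le hk
  have hexp : -(p : ℝ) / (2 * (p : ℝ) - 4) = -q⁻¹ := by rw [hqdef, inv_div, neg_div]
  have hd1 : ∀ t ∈ Icc (0 : ℝ) T, HasDerivWithinAt (fun t => s1 t ^ (-q))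
      (k * s1 t * (s1 t ^ 2 + s2 t ^ 2) ^ m * (-q) * s1 t ^ (-q - 1)) (Icc 0 T) t :=
    fun t ht => (hds1 t ht).rpow_const (Or.inl (hpos1 t ht).ne')
  have hd2 : ∀ t ∈ Icc (0 : ℝ) T, HasDerivWithinAt (fun t => s2 t ^ (-q))
      (-(k * s2 t * (s1 t ^ 2 + s2 t ^ 2) ^ m) * (-q) * s2 t ^ (-q - 1)) (Icc 0 T) t :=
    fun t ht => (hds2 t ht).rpow_const (Or.inl (hpos2 t ht).ne')
  have hbound1 : ∀ t ∈ interior (Icc (0 : ℝ) T), deriv (fun t => s1 t ^ (-q)) t ≤ -C0 := by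
    intro t ht
    have ht' := interior_subset ht
    rw [((hd1 t ht').hasDerivAt (mem_interior_iff_mem_nhds.mp ht)).deriv]
    have := mul_le_mul_rpow_neg_sub_one (hpos1 t ht') hq.le hk
      (hqm ▸ rpow_two_mul_le_sq_add_sq_rpow (s2 t) (hpos1 t ht').le hm)
    linarith
  have hbound2 : ∀ t ∈ interior (Icc (0 : ℝ) T), C0 ≤ deriv (fun t => s2 t ^ (-q)) t := by
    intro t ht
    have ht' := interior_subset ht
    rw [((hd2 t ht').hasDerivAt (mem_interior_iff_mem_nhds.mp ht)).deriv]
    have := mul_le_mul_rpow_neg_sub_one (hpos2 t ht') hq.le hk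
      (hqm ▸ rpow_two_mul_le_sq_add_sq_rpow (s1 t) (hpos2 t ht').le hm)
    rw [add_comm (s2 t ^ 2)] at this
    linarith
  rw [hexp]
  refine ⟨fun t b ht htb hb => ?_, fun a t ha hat ht => ?_⟩
  · have htT : t ∈ Icc 0 T := ⟨ht, htb.trans hb⟩
    have hbT : b ∈ Icc 0 T := ⟨ht.trans htb, hb⟩
    have hmvt := (convex_Icc 0 T).image_sub_le_mul_sub_of_deriv_le
      (fun t ht => (hd1 t ht).continuousWithinAt)
      (fun t ht => ((hd1 t (interior_subset ht)).mono interior_subset).differentiableWithinAt)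
      hbound1 t htT b hbT htb
    rw [mul_right_comm]
    exact le_mul_one_add_rpow_of_rpow_neg_add_le (hpos1 t htT) (hpos1 b hbT) hq
      (mul_nonneg hC_nonneg (sub_nonneg.mpr htb)) (by linarith)
  · have htT : t ∈ Icc 0 T := ⟨ha.trans hat, ht⟩
    have haT : a ∈ Icc 0 T := ⟨ha, hat.trans ht⟩
    have hmvt := (convex_Icc 0 T).mul_sub_le_image_sub_of_le_deriv
      (fun t ht => (hd2 t ht).continuousWithinAt)
      (fun t ht => ((hd2 t (interior_subset ht)).mono interior_subset).differentiableWithinAt)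
      hbound2 a haT t htT hat
    rw [mul_right_comm]
    exact le_mul_one_add_rpow_of_rpow_neg_add_le (hpos2 t htT) (hpos2 a haT) hq
      (mul_nonneg hC_nonneg (sub_nonneg.mpr hat)) (by linarith)
end

section
/- Let s = (s₁,s₂) : [0,T] → ℝ² be a solution of the explicit slowdown ODE with s₁(t) > 0, s₂(t) > 0 and s₁(t)²+s₂(t)² ≤ r̃₁² for all t ∈ [0,T], and let T₁ ∈ [0,T] be such that s₁(t) ≤ s₂(t) for 0 ≤ t ≤ T₁ and s₂(t) ≤ s₁(t) for T₁ ≤ t ≤ T. Then: (c) for all 0 ≤ a ≤ t ≤ T₁, s₂(t) ≥ s₂(a)·(1 + 2^{(p−2)/p}·C₀·s₂(a)^{(2p−4)/p}·(t−a))^{−p/(2p−4)}; and (d) for all T₁ ≤ t ≤ b ≤ T, s₁(t) ≥ s₁(b)·(1 + 2^{(p−2)/p}·C₀·s₁(b)^{(2p−4)/p}·(b−t))^{−p/(2p−4)}. -/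
open Real Set

/-- Comparison principle for `f' ≥ -K f ^ (1 + q)`: a positive function obeying this inequality on
`[c, d]` dominates at `d` the solution of `y' = -K y ^ (1 + q)` with `y c = f c`. -/
theorem mul_one_add_rpow_neg_le_of_deriv_ge {f f' : ℝ → ℝ} {c d q K : ℝ} (hq : 0 < q)
    (hK : 0 ≤ K) (hcd : c ≤ d)
    (hf : ∀ x ∈ Icc c d, HasDerivWithinAt f (f' x) (Icc c d) x)
    (hpos : ∀ x ∈ Icc c d, 0 < f x)
    (hf' : ∀ x ∈ Icc c d, -(K * f x * f x ^ q) ≤ f' x) :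
    f c * (1 + q * K * f c ^ q * (d - c)) ^ (-q⁻¹) ≤ f d := by
  have hc : c ∈ Icc c d := left_mem_Icc.2 hcd
  have hd : d ∈ Icc c d := right_mem_Icc.2 hcd
  have hder : ∀ x ∈ Icc c d, HasDerivWithinAt (fun y => f y ^ (-q) - q * K * y)
      (f' x * (-q) * f x ^ (-q - 1) - q * K) (Icc c d) x := fun x hx => by
    have h := ((hf x hx).rpow_const (p := -q) (Or.inl (hpos x hx).ne')).sub
      ((hasDerivWithinAt_id x _).const_mul (q * K))
    rw [mul_one] at h
    exact h
  have hanti : AntitoneOn (fun y => f y ^ (-q) - q * K * y) (Icc c d) := by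
    refine antitoneOn_of_hasDerivWithinAt_nonpos (convex_Icc c d)
      (fun x hx => (hder x hx).continuousWithinAt)
      (fun x hx => (hder x (interior_subset hx)).mono interior_subset) fun x hx => ?_
    have hx' := interior_subset hx
    have hfx := hpos x hx'
    have hone : f x * f x ^ q * f x ^ (-q - 1) = 1 := by
      rw [rpow_sub_one hfx.ne', rpow_neg hfx.le]
      have := (rpow_pos_of_pos hfx q).ne'
      field_simp
    have hmul := mul_le_mul_of_nonneg_right (hf' x hx')
      (mul_nonneg hq.le (rpow_pos_of_pos hfx (-q - 1)).le)
    linear_combination hmul + q * K * hone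
  have hle : f d ^ (-q) ≤ f c ^ (-q) + q * K * (d - c) := by
    have := hanti hc hd hcd
    simp only at this
    linarith
  have hfc := hpos c hc
  have hfd := hpos d hd
  have hA : 0 < 1 + q * K * f c ^ q * (d - c) := by
    have := rpow_pos_of_pos hfc q
    have : 0 ≤ d - c := sub_nonneg.2 hcd
    positivity
  have hfac : f c ^ (-q) + q * K * (d - c) =
      f c ^ (-q) * (1 + q * K * f c ^ q * (d - c)) := by
    have : f c ^ (-q) * f c ^ q = 1 := by rw [← rpow_add hfc]; simp
    linear_combination (-(q * K * (d - c))) * this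
  have hinv : ∀ y : ℝ, 0 < y → (y ^ (-q)) ^ (-q⁻¹) = y := fun y hy => by
    rw [← rpow_mul hy.le, neg_mul_neg, mul_inv_cancel₀ hq.ne', rpow_one]
  calc f c * (1 + q * K * f c ^ q * (d - c)) ^ (-q⁻¹)
      = (f c ^ (-q) * (1 + q * K * f c ^ q * (d - c))) ^ (-q⁻¹) := by
        rw [mul_rpow (rpow_pos_of_pos hfc _).le hA.le, hinv _ hfc]
    _ ≤ (f d ^ (-q)) ^ (-q⁻¹) := by
        rw [← hfac]
        exact rpow_le_rpow_of_nonpos (rpow_pos_of_pos hfd _) hle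
          (neg_nonpos.2 (inv_nonneg.2 hq.le))
    _ = f d := hinv _ hfd

/-- The slowdown factor is at most its value on the diagonal through the larger coordinate. -/
theorem sq_add_sq_rpow_le {x y q : ℝ} (hq : 0 ≤ q) (hx : 0 ≤ x) (hxy : x ≤ y) :
    (x ^ 2 + y ^ 2) ^ q ≤ 2 ^ q * y ^ (2 * q) := by
  have hy : 0 ≤ y := hx.trans hxy
  rw [rpow_mul hy, rpow_two, ← mul_rpow zero_le_two (sq_nonneg y)]
  exact rpow_le_rpow (by positivity) (by nlinarith) hq

/-- For a positive solution of the explicit slowdown ODE staying in the disc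
`D_{r̃₁}` on `[0,T]`, with `T₁` the switching time between `s₁ ≤ s₂` and `s₂ ≤ s₁`:
(c) `s₂(t) ≥ s₂(a)·(1 + 2^{(p−2)/p}·C₀·s₂(a)^{(2p−4)/p}·(t−a))^{−p/(2p−4)}` for
`0 ≤ a ≤ t ≤ T₁`, and
(d) `s₁(t) ≥ s₁(b)·(1 + 2^{(p−2)/p}·C₀·s₁(b)^{(2p−4)/p}·(b−t))^{−p/(2p−4)}` for
`T₁ ≤ t ≤ b ≤ T`. -/
theorem s1_s2_lower_estimates
    (p : ℕ) (hp : 3 ≤ p) (lam : ℝ) (hlam : 1 < lam)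
    (r0 r1 : ℝ) (hr1 : 0 < r1) (hr01 : r1 < r0)
    (rt1 : ℝ) (hrt1 : rt1 = (2 / (p : ℝ)) * r1 ^ ((p : ℝ) / 2))
    (C0 : ℝ)
    (hC0 : C0 = ((2 * (p : ℝ) - 4) / p) * ((p : ℝ) / 2) ^ ((2 * (p : ℝ) - 4) / p) *
      Real.log lam)
    (T T1 : ℝ) (hT1 : T1 ∈ Set.Icc (0 : ℝ) T) (s1 s2 : ℝ → ℝ)
    (hds1 : ∀ t ∈ Set.Icc (0 : ℝ) T, HasDerivWithinAt s1
      (Real.log lam * ((p : ℝ) / 2) ^ ((2 * (p : ℝ) - 4) / p) * s1 t *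
        (s1 t ^ 2 + s2 t ^ 2) ^ (((p : ℝ) - 2) / p)) (Set.Icc 0 T) t)
    (hds2 : ∀ t ∈ Set.Icc (0 : ℝ) T, HasDerivWithinAt s2
      (-(Real.log lam * ((p : ℝ) / 2) ^ ((2 * (p : ℝ) - 4) / p) * s2 t *
        (s1 t ^ 2 + s2 t ^ 2) ^ (((p : ℝ) - 2) / p))) (Set.Icc 0 T) t)
    (hpos1 : ∀ t ∈ Set.Icc (0 : ℝ) T, 0 < s1 t)
    (hpos2 : ∀ t ∈ Set.Icc (0 : ℝ) T, 0 < s2 t)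
    (hdisc : ∀ t ∈ Set.Icc (0 : ℝ) T, s1 t ^ 2 + s2 t ^ 2 ≤ rt1 ^ 2)
    (hT1a : ∀ t ∈ Set.Icc (0 : ℝ) T1, s1 t ≤ s2 t)
    (hT1b : ∀ t ∈ Set.Icc T1 T, s2 t ≤ s1 t) :
    (∀ a t : ℝ, 0 ≤ a → a ≤ t → t ≤ T1 →
      s2 a *
        (1 + (2 : ℝ) ^ (((p : ℝ) - 2) / p) * C0 * s2 a ^ ((2 * (p : ℝ) - 4) / p) *
          (t - a)) ^ (-(p : ℝ) / (2 * (p : ℝ) - 4)) ≤ s2 t) ∧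
    (∀ t b : ℝ, T1 ≤ t → t ≤ b → b ≤ T →
      s1 b *
        (1 + (2 : ℝ) ^ (((p : ℝ) - 2) / p) * C0 * s1 b ^ ((2 * (p : ℝ) - 4) / p) *
          (b - t)) ^ (-(p : ℝ) / (2 * (p : ℝ) - 4)) ≤ s1 t) := by
  have hp' : (3 : ℝ) ≤ p := by exact_mod_cast hp
  have hp0 : (0 : ℝ) < p := by linarith
  have hp2 : (0 : ℝ) < 2 * (p : ℝ) - 4 := by linarith
  set q : ℝ := (2 * (p : ℝ) - 4) / p with hq
  have hqpos : 0 < q := div_pos hp2 hp0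
  have hexp : -(p : ℝ) / (2 * (p : ℝ) - 4) = -q⁻¹ := by rw [hq, inv_div, neg_div]
  have hhalf : ((p : ℝ) - 2) / p = q / 2 := by rw [hq]; ring
  rw [hhalf] at hds1 hds2 ⊢
  rw [hexp]
  set k : ℝ := Real.log lam * ((p : ℝ) / 2) ^ q with hk
  have hkpos : 0 ≤ k := mul_nonneg (Real.log_pos hlam).le (by positivity)
  have hKpos : 0 ≤ 2 ^ (q / 2) * k := by positivity
  have hC : (2 : ℝ) ^ (q / 2) * C0 = q * (2 ^ (q / 2) * k) := by rw [hC0, hk]; ring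
  have hbound : ∀ x y : ℝ, 0 < x → x ≤ y →
      k * y * (x ^ 2 + y ^ 2) ^ (q / 2) ≤ 2 ^ (q / 2) * k * y * y ^ q := fun x y hx hxy => by
    have h := sq_add_sq_rpow_le (q := q / 2) (by positivity) hx.le hxy
    rw [mul_div_cancel₀ q two_ne_zero] at h
    have := mul_le_mul_of_nonneg_left h (mul_nonneg hkpos (hx.le.trans hxy))
    linarith
  rw [hC]
  refine ⟨fun a t ha hat ht => ?_, fun t b ht htb hb => ?_⟩
  · have hsub : Icc a t ⊆ Icc 0 T := Icc_subset_Icc ha (ht.trans hT1.2)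
    exact mul_one_add_rpow_neg_le_of_deriv_ge hqpos hKpos hat
      (fun x hx => (hds2 x (hsub hx)).mono hsub) (fun x hx => hpos2 x (hsub hx))
      fun x hx => neg_le_neg (hbound _ _ (hpos1 x (hsub hx))
        (hT1a x ⟨ha.trans hx.1, hx.2.trans ht⟩))
  · have hsub : MapsTo (fun x : ℝ => -x) (Icc (-b) (-t)) (Icc 0 T) := fun x hx =>
      ⟨by linarith [hx.2, hT1.1], by linarith [hx.1]⟩
    have h := mul_one_add_rpow_neg_le_of_deriv_ge (f := fun x => s1 (-x)) hqpos hKpos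
      (neg_le_neg htb)
      (fun x hx => (hds1 (-x) (hsub hx)).comp x (hasDerivWithinAt_neg x _) hsub)
      (fun x hx => hpos1 (-x) (hsub hx))
      fun x hx => by
        have := hbound _ _ (hpos2 (-x) (hsub hx))
          (hT1b (-x) ⟨by linarith [hx.2], by linarith [hx.1]⟩)
        rw [add_comm (s2 (-x) ^ 2)] at this
        linarith
    simpa [neg_add_eq_sub] using h
end

section
/- Let s = (s₁,s₂) : [0,T] → ℝ² be a solution of the explicit slowdown ODE with s₁(t) > 0, s₂(t) > 0 and s₁(t)²+s₂(t)² ≤ r̃₁² for all t ∈ [0,T]. Then for all 0 ≤ a ≤ b ≤ T one has s₂(b)^{−(2p−4)/p} − s₂(a)^{−(2p−4)/p} ≥ C₀·(b−a) and s₁(a)^{−(2p−4)/p} − s₁(b)^{−(2p−4)/p} ≥ C₀·(b−a). -/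
open Real Set

/-- If `u > 0` solves `u' = σ c u` on an interval, where `σ² = 1` and `c ≥ K u ^ q`, then
`-σ u ^ (-q)` grows at least at rate `q K`. -/
theorem mul_sub_le_rpow_neg_sub_of_hasDerivWithinAt {T K q σ : ℝ} (hq : 0 ≤ q) (hσ : σ * σ = 1)
    {u c : ℝ → ℝ}
    (hu : ∀ t ∈ Icc (0 : ℝ) T, HasDerivWithinAt u (σ * (c t * u t)) (Icc 0 T) t)
    (hpos : ∀ t ∈ Icc (0 : ℝ) T, 0 < u t)
    (hc : ∀ t ∈ Icc (0 : ℝ) T, K * u t ^ q ≤ c t)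
    {a b : ℝ} (ha : 0 ≤ a) (hab : a ≤ b) (hb : b ≤ T) :
    q * K * (b - a) ≤ -σ * (u b ^ (-q) - u a ^ (-q)) := by
  have hd : ∀ t ∈ Icc (0 : ℝ) T,
      HasDerivWithinAt (fun t => -σ * u t ^ (-q) - q * K * t)
        (q * (c t * u t ^ (-q) - K)) (Icc 0 T) t := by
    intro t ht
    have hut := hpos t ht
    refine ((((hu t ht).rpow_const (p := -q) (Or.inl hut.ne')).const_mul (-σ)).sub
      ((hasDerivWithinAt_id t _).const_mul (q * K))).congr_deriv ?_
    rw [rpow_sub_one hut.ne']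
    field_simp
    linear_combination (q * c t * u t ^ (-q)) * hσ
  have hmono : MonotoneOn (fun t => -σ * u t ^ (-q) - q * K * t) (Icc 0 T) := by
    refine monotoneOn_of_hasDerivWithinAt_nonneg (convex_Icc 0 T)
      (fun t ht => (hd t ht).continuousWithinAt)
      (fun t ht => (hd t (interior_subset ht)).mono interior_subset) (fun t ht => ?_)
    have ht' := interior_subset ht
    have hut := hpos t ht'
    refine mul_nonneg hq (sub_nonneg.2 ?_)
    calc K = K * u t ^ q * u t ^ (-q) := by
          rw [mul_assoc, ← rpow_add hut, add_neg_cancel, rpow_zero, mul_one]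
      _ ≤ c t * u t ^ (-q) :=
          mul_le_mul_of_nonneg_right (hc t ht') (rpow_nonneg hut.le _)
  have h := hmono ⟨ha, hab.trans hb⟩ ⟨ha.trans hab, hb⟩ hab
  simp only at h
  linarith

theorem rpow_two_mul_le_rpow_of_sq_le {x y r : ℝ} (hx : 0 ≤ x) (hr : 0 ≤ r) (h : x ^ 2 ≤ y) :
    x ^ (2 * r) ≤ y ^ r := by
  rw [rpow_mul hx, rpow_two]
  exact rpow_le_rpow (sq_nonneg x) h hr

/-- For a positive solution of the explicit slowdown ODE staying in the disc
`D_{r̃₁}` on `[0,T]`, for all `0 ≤ a ≤ b ≤ T` one has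
`s₂(b)^{−(2p−4)/p} − s₂(a)^{−(2p−4)/p} ≥ C₀·(b−a)` and
`s₁(a)^{−(2p−4)/p} − s₁(b)^{−(2p−4)/p} ≥ C₀·(b−a)`. -/
theorem reciprocal_power_estimates
    (p : ℕ) (hp : 3 ≤ p) (lam : ℝ) (hlam : 1 < lam)
    (r0 r1 : ℝ) (hr1 : 0 < r1) (hr01 : r1 < r0)
    (rt1 : ℝ) (hrt1 : rt1 = (2 / (p : ℝ)) * r1 ^ ((p : ℝ) / 2))
    (C0 : ℝ)
    (hC0 : C0 = ((2 * (p : ℝ) - 4) / p) * ((p : ℝ) / 2) ^ ((2 * (p : ℝ) - 4) / p) *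
      Real.log lam)
    (T : ℝ) (hT : 0 ≤ T) (s1 s2 : ℝ → ℝ)
    (hds1 : ∀ t ∈ Set.Icc (0 : ℝ) T, HasDerivWithinAt s1
      (Real.log lam * ((p : ℝ) / 2) ^ ((2 * (p : ℝ) - 4) / p) * s1 t *
        (s1 t ^ 2 + s2 t ^ 2) ^ (((p : ℝ) - 2) / p)) (Set.Icc 0 T) t)
    (hds2 : ∀ t ∈ Set.Icc (0 : ℝ) T, HasDerivWithinAt s2
      (-(Real.log lam * ((p : ℝ) / 2) ^ ((2 * (p : ℝ) - 4) / p) * s2 t *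
        (s1 t ^ 2 + s2 t ^ 2) ^ (((p : ℝ) - 2) / p))) (Set.Icc 0 T) t)
    (hpos1 : ∀ t ∈ Set.Icc (0 : ℝ) T, 0 < s1 t)
    (hpos2 : ∀ t ∈ Set.Icc (0 : ℝ) T, 0 < s2 t)
    (hdisc : ∀ t ∈ Set.Icc (0 : ℝ) T, s1 t ^ 2 + s2 t ^ 2 ≤ rt1 ^ 2) :
    ∀ a b : ℝ, 0 ≤ a → a ≤ b → b ≤ T →
      C0 * (b - a) ≤
        s2 b ^ (-(2 * (p : ℝ) - 4) / p) - s2 a ^ (-(2 * (p : ℝ) - 4) / p) ∧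
      C0 * (b - a) ≤
        s1 a ^ (-(2 * (p : ℝ) - 4) / p) - s1 b ^ (-(2 * (p : ℝ) - 4) / p) := by
  intro a b ha hab hb
  have hp0 : (0 : ℝ) < p := by exact_mod_cast (by omega : 0 < p)
  have hp3 : (3 : ℝ) ≤ p := by exact_mod_cast hp
  have hr : 0 ≤ ((p : ℝ) - 2) / p := div_nonneg (by linarith) hp0.le
  have hqr : (2 * (p : ℝ) - 4) / p = 2 * (((p : ℝ) - 2) / p) := by ring
  have hq : 0 ≤ (2 * (p : ℝ) - 4) / p := by rw [hqr]; positivity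
  have hK : 0 ≤ Real.log lam * ((p : ℝ) / 2) ^ ((2 * (p : ℝ) - 4) / p) :=
    mul_nonneg (Real.log_nonneg hlam.le) (by positivity)
  rw [neg_div]
  constructor
  · have h := mul_sub_le_rpow_neg_sub_of_hasDerivWithinAt (σ := -1)
      (K := Real.log lam * ((p : ℝ) / 2) ^ ((2 * (p : ℝ) - 4) / p))
      (c := fun t => Real.log lam * ((p : ℝ) / 2) ^ ((2 * (p : ℝ) - 4) / p) *
        (s1 t ^ 2 + s2 t ^ 2) ^ (((p : ℝ) - 2) / p)) hq (by norm_num)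
      (fun t ht => (hds2 t ht).congr_deriv (by ring)) hpos2
      (fun t ht => mul_le_mul_of_nonneg_left (hqr ▸ rpow_two_mul_le_rpow_of_sq_le
        (hpos2 t ht).le hr (le_add_of_nonneg_left (sq_nonneg _))) hK) ha hab hb
    rw [hC0]
    linarith
  · have h := mul_sub_le_rpow_neg_sub_of_hasDerivWithinAt (σ := 1)
      (K := Real.log lam * ((p : ℝ) / 2) ^ ((2 * (p : ℝ) - 4) / p))
      (c := fun t => Real.log lam * ((p : ℝ) / 2) ^ ((2 * (p : ℝ) - 4) / p) *
        (s1 t ^ 2 + s2 t ^ 2) ^ (((p : ℝ) - 2) / p)) hq (by norm_num)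
      (fun t ht => (hds1 t ht).congr_deriv (by ring)) hpos1
      (fun t ht => mul_le_mul_of_nonneg_left (hqr ▸ rpow_two_mul_le_rpow_of_sq_le
        (hpos1 t ht).le hr (le_add_of_nonneg_right (sq_nonneg _))) hK) ha hab hb
    rw [hC0]
    linarith
end

section
/- Under the two-solution hypotheses, for all 0 ≤ t ≤ T₁ one has Δs₂(t) ≤ (Δs₂(0)/s₂(0))·s₂(t)·(1 + 2^{(p−2)/p}·C₀·s₂(0)^{(2p−4)/p}·t)^{−β}. -/
open Real Set

/-- The tangent-line bound for the concave power `x ↦ x ^ e`, with tangent taken at `v`. -/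
theorem rpow_mul_sub_div_le_rpow_sub_rpow {e u v : ℝ} (he0 : 0 ≤ e) (he1 : e ≤ 1)
    (hu : 0 ≤ u) (hv : 0 < v) : e * v ^ e * ((v - u) / v) ≤ v ^ e - u ^ e := by
  have hs : -1 ≤ (u - v) / v := by
    rw [le_div_iff₀ hv]; linarith
  have h := rpow_one_add_le_one_add_mul_self hs he0 he1
  have h1 : 1 + (u - v) / v = u / v := by field_simp; ring
  rw [h1, Real.div_rpow hu hv.le, div_le_iff₀ (Real.rpow_pos_of_pos hv e)] at h
  have h2 : (v - u) / v = -((u - v) / v) := by ring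
  rw [h2]
  linarith

/-- If the second coordinate dominates the first, then moving by more in the second coordinate
than in the first increases the squared norm quantitatively. -/
theorem mul_sub_le_sq_add_sq_sub {α x y x' y' : ℝ}
    (hx : 0 < x) (hxy : x ≤ y) (hd1 : |x' - x| ≤ α * (y' - y)) :
    2 * (1 - α) * y * (y' - y) ≤ (x' ^ 2 + y' ^ 2) - (x ^ 2 + y ^ 2) := by
  have hαd : 0 ≤ α * (y' - y) := (abs_nonneg _).trans hd1
  have hlow := (abs_le.mp hd1).1
  nlinarith [sq_nonneg (x' - x), sq_nonneg (y' - y), mul_le_mul_of_nonneg_left hlow hx.le,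
    mul_nonneg (sub_nonneg.mpr hxy) hαd]

theorem rpow_sq_add_sq_sub_lower_bound {α e x y x' y' : ℝ} (hα : α < 1)
    (he0 : 0 ≤ e) (he1 : e ≤ 1) (hx : 0 < x) (hxy : x ≤ y) (hd : 0 < y' - y)
    (hd1 : |x' - x| ≤ α * (y' - y)) (hd2 : y' ≤ 2 * y) :
    (1 - α) * (e / 2) * y ^ (2 * e) * (y' / y - 1) ≤
      y' / y * ((x' ^ 2 + y' ^ 2) ^ e - (x ^ 2 + y ^ 2) ^ e) := by
  have hy : 0 < y := hx.trans_le hxy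
  have hy' : 0 < y' := by linarith
  have hdiff := mul_sub_le_sq_add_sq_sub hx hxy hd1
  have hα' : 0 < 1 - α := by linarith
  have hyd : 0 ≤ 2 * (1 - α) * y * (y' - y) := by positivity
  have hv : 0 < x' ^ 2 + y' ^ 2 := by positivity
  have hpow : y ^ (2 * e) ≤ (x' ^ 2 + y' ^ 2) ^ e := by
    rw [Real.rpow_mul hy.le, Real.rpow_two]
    exact Real.rpow_le_rpow (sq_nonneg y) (by nlinarith [sq_nonneg x]) he0
  have hx' : x' ^ 2 ≤ y' ^ 2 := by
    have h := abs_le.mp hd1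
    apply sq_le_sq' <;> nlinarith
  have hquot : (1 - α) * y * (y' - y) / y' ^ 2 ≤
      ((x' ^ 2 + y' ^ 2) - (x ^ 2 + y ^ 2)) / (x' ^ 2 + y' ^ 2) := by
    rw [div_le_div_iff₀ (by positivity) hv]
    have hc : 0 ≤ (1 - α) * y * (y' - y) := by positivity
    nlinarith [mul_le_mul_of_nonneg_left hx' hc,
      mul_le_mul_of_nonneg_right hdiff (sq_nonneg y')]
  have hq0 : 0 ≤ (1 - α) * y * (y' - y) / y' ^ 2 := by positivity
  calc (1 - α) * (e / 2) * y ^ (2 * e) * (y' / y - 1)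
      = e * y ^ (2 * e) * (1 - α) * ((y' - y) / (2 * y)) := by field_simp
    _ ≤ e * y ^ (2 * e) * (1 - α) * ((y' - y) / y') := by gcongr
    _ = y' / y * (e * y ^ (2 * e) * ((1 - α) * y * (y' - y) / y' ^ 2)) := by field_simp
    _ ≤ y' / y * (e * (x' ^ 2 + y' ^ 2) ^ e *
          (((x' ^ 2 + y' ^ 2) - (x ^ 2 + y ^ 2)) / (x' ^ 2 + y' ^ 2))) := by gcongr
    _ ≤ y' / y * ((x' ^ 2 + y' ^ 2) ^ e - (x ^ 2 + y ^ 2) ^ e) := by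
        gcongr
        exact rpow_mul_sub_div_le_rpow_sub_rpow he0 he1 (by positivity) hv

theorem antitoneOn_Icc_of_hasDerivWithinAt_nonpos {f f' : ℝ → ℝ} {a b : ℝ}
    (hf : ∀ t ∈ Icc a b, HasDerivWithinAt f (f' t) (Icc a b) t)
    (hf' : ∀ t ∈ Icc a b, f' t ≤ 0) : AntitoneOn f (Icc a b) :=
  antitoneOn_of_hasDerivWithinAt_nonpos (convex_Icc a b)
    (fun t ht => (hf t ht).continuousWithinAt)
    (fun t ht => (hf t (interior_subset ht)).mono interior_subset)
    (fun t ht => hf' t (interior_subset ht))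

/-- A positive `y` with `y' = -K y (x² + y²)^e` and `x ≤ y` decays at most like the
solution of `y' = -2^e K y^(1 + 2e)`. -/
theorem rpow_div_le_rpow_of_slowdown {K e τ : ℝ} {x y : ℝ → ℝ} (hK : 0 ≤ K) (he : 0 ≤ e)
    (hx : ∀ t ∈ Icc 0 τ, 0 < x t) (hxy : ∀ t ∈ Icc 0 τ, x t ≤ y t)
    (hy : ∀ t ∈ Icc 0 τ, HasDerivWithinAt y (-(K * y t * (x t ^ 2 + y t ^ 2) ^ e))
      (Icc 0 τ) t)
    {t : ℝ} (ht : t ∈ Icc 0 τ) :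
    y 0 ^ (2 * e) / (1 + 2 ^ e * (2 * e * K) * y 0 ^ (2 * e) * t) ≤ y t ^ (2 * e) := by
  have hpos : ∀ t ∈ Icc 0 τ, 0 < y t := fun t ht => (hx t ht).trans_le (hxy t ht)
  have h0 : (0 : ℝ) ∈ Icc 0 τ := ⟨le_rfl, ht.1.trans ht.2⟩
  have hanti : AntitoneOn (fun t => y t ^ (-(2 * e)) - 2 ^ e * (2 * e * K) * t) (Icc 0 τ) := by
    apply antitoneOn_Icc_of_hasDerivWithinAt_nonpos
      (f' := fun t => -(K * y t * (x t ^ 2 + y t ^ 2) ^ e) * (-(2 * e)) *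
        y t ^ (-(2 * e) - 1) - 2 ^ e * (2 * e * K) * 1)
    · intro t ht
      exact ((hy t ht).rpow_const (Or.inl (hpos t ht).ne')).sub
        ((hasDerivWithinAt_id t _).const_mul _)
    · intro t ht
      have hyt := hpos t ht
      have hbound : (x t ^ 2 + y t ^ 2) ^ e ≤ 2 ^ e * y t ^ (2 * e) := by
        rw [Real.rpow_mul hyt.le, Real.rpow_two, ← Real.mul_rpow two_pos.le (sq_nonneg _)]
        apply Real.rpow_le_rpow (by positivity) _ he
        nlinarith [hx t ht, hxy t ht]
      have hcancel : y t * y t ^ (-(2 * e) - 1) * y t ^ (2 * e) = 1 := by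
        rw [Real.rpow_sub_one hyt.ne', Real.rpow_neg hyt.le]
        have := Real.rpow_pos_of_pos hyt (2 * e)
        field_simp
      have hc : 0 ≤ 2 * e * K * (y t * y t ^ (-(2 * e) - 1)) := by positivity
      have := mul_le_mul_of_nonneg_left hbound hc
      linear_combination this + 2 ^ e * (2 * e * K) * hcancel
  have h := hanti h0 ht ht.1
  have hA : 0 < y 0 ^ (2 * e) := Real.rpow_pos_of_pos (hpos 0 h0) _
  have hB : 0 < y t ^ (2 * e) := Real.rpow_pos_of_pos (hpos t ht) _
  have ht0 := ht.1
  have hD : 0 < 1 + 2 ^ e * (2 * e * K) * y 0 ^ (2 * e) * t := by positivity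
  simp only [Real.rpow_neg (hpos 0 h0).le, Real.rpow_neg (hpos t ht).le, mul_zero,
    sub_zero] at h
  rw [div_le_iff₀ hD]
  have h' := mul_le_mul_of_nonneg_left h (mul_pos hA hB).le
  have e1 : y 0 ^ (2 * e) * y t ^ (2 * e) * (y t ^ (2 * e))⁻¹ = y 0 ^ (2 * e) := by
    field_simp
  have e2 : y 0 ^ (2 * e) * y t ^ (2 * e) * (y 0 ^ (2 * e))⁻¹ = y t ^ (2 * e) := by
    field_simp
  linear_combination h' + e2 - e1

/-- A function `f` with `f' ≤ -β A f / (1 + A t)` decays like `(1 + A t)^(-β)`. -/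
theorem le_mul_one_add_mul_rpow_neg {A β τ : ℝ} {f f' : ℝ → ℝ} (hA : 0 ≤ A)
    (hf : ∀ t ∈ Icc 0 τ, HasDerivWithinAt f (f' t) (Icc 0 τ) t)
    (hf' : ∀ t ∈ Icc 0 τ, f' t ≤ -(β * (A / (1 + A * t)) * f t))
    {t : ℝ} (ht : t ∈ Icc 0 τ) : f t ≤ f 0 * (1 + A * t) ^ (-β) := by
  have hpos : ∀ t ∈ Icc 0 τ, 0 < 1 + A * t := fun t ht => by
    have := mul_nonneg hA ht.1
    linarith
  have hanti : AntitoneOn (fun t => f t * (1 + A * t) ^ β) (Icc 0 τ) := by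
    apply antitoneOn_Icc_of_hasDerivWithinAt_nonpos
      (f' := fun t => f' t * (1 + A * t) ^ β +
        f t * (A * 1 * β * (1 + A * t) ^ (β - 1)))
    · intro t ht
      exact (hf t ht).mul ((((hasDerivWithinAt_id t _).const_mul A).const_add 1).rpow_const
        (Or.inl (hpos t ht).ne'))
    · intro t ht
      have h := mul_le_mul_of_nonneg_right (hf' t ht) (Real.rpow_pos_of_pos (hpos t ht) β).le
      rw [Real.rpow_sub_one (hpos t ht).ne']
      linear_combination h
  have h := hanti ⟨le_rfl, ht.1.trans ht.2⟩ ht ht.1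
  simp only [mul_zero, add_zero, Real.one_rpow, mul_one] at h
  rwa [Real.rpow_neg (hpos t ht).le, ← div_eq_mul_inv,
    le_div_iff₀ (Real.rpow_pos_of_pos (hpos t ht) β)]

/-- Under the two-solution hypotheses, for `0 ≤ t ≤ T₁`,
`Δs₂(t) ≤ (Δs₂(0)/s₂(0))·s₂(t)·(1 + 2^{(p−2)/p}·C₀·s₂(0)^{(2p−4)/p}·t)^{−β}`. -/
theorem spread_in_slowdown_first
    (p : ℕ) (hp : 3 ≤ p) (lam : ℝ) (hlam : 1 < lam)
    (r0 r1 : ℝ) (hr1 : 0 < r1) (hr01 : r1 < r0)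
    (rt1 : ℝ) (hrt1 : rt1 = (2 / (p : ℝ)) * r1 ^ ((p : ℝ) / 2))
    (C0 : ℝ)
    (hC0 : C0 = ((2 * (p : ℝ) - 4) / p) * ((p : ℝ) / 2) ^ ((2 * (p : ℝ) - 4) / p) *
      Real.log lam)
    (T T1 : ℝ) (hT1 : T1 ∈ Set.Icc (0 : ℝ) T)
    (s1 s2 ts1 ts2 : ℝ → ℝ)
    (hds1 : ∀ t ∈ Set.Icc (0 : ℝ) T, HasDerivWithinAt s1
      (Real.log lam * ((p : ℝ) / 2) ^ ((2 * (p : ℝ) - 4) / p) * s1 t *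
        (s1 t ^ 2 + s2 t ^ 2) ^ (((p : ℝ) - 2) / p)) (Set.Icc 0 T) t)
    (hds2 : ∀ t ∈ Set.Icc (0 : ℝ) T, HasDerivWithinAt s2
      (-(Real.log lam * ((p : ℝ) / 2) ^ ((2 * (p : ℝ) - 4) / p) * s2 t *
        (s1 t ^ 2 + s2 t ^ 2) ^ (((p : ℝ) - 2) / p))) (Set.Icc 0 T) t)
    (hdts1 : ∀ t ∈ Set.Icc (0 : ℝ) T, HasDerivWithinAt ts1
      (Real.log lam * ((p : ℝ) / 2) ^ ((2 * (p : ℝ) - 4) / p) * ts1 t *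
        (ts1 t ^ 2 + ts2 t ^ 2) ^ (((p : ℝ) - 2) / p)) (Set.Icc 0 T) t)
    (hdts2 : ∀ t ∈ Set.Icc (0 : ℝ) T, HasDerivWithinAt ts2
      (-(Real.log lam * ((p : ℝ) / 2) ^ ((2 * (p : ℝ) - 4) / p) * ts2 t *
        (ts1 t ^ 2 + ts2 t ^ 2) ^ (((p : ℝ) - 2) / p))) (Set.Icc 0 T) t)
    (hpos1 : ∀ t ∈ Set.Icc (0 : ℝ) T, 0 < s1 t)
    (hpos2 : ∀ t ∈ Set.Icc (0 : ℝ) T, 0 < s2 t)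
    (hdisc : ∀ t ∈ Set.Icc (0 : ℝ) T, s1 t ^ 2 + s2 t ^ 2 ≤ rt1 ^ 2)
    (hdisc' : ∀ t ∈ Set.Icc (0 : ℝ) T, ts1 t ^ 2 + ts2 t ^ 2 ≤ rt1 ^ 2)
    (hΔ2 : ∀ t ∈ Set.Icc (0 : ℝ) T, 0 < ts2 t - s2 t)
    (hT1a : ∀ t ∈ Set.Icc (0 : ℝ) T1, s1 t ≤ s2 t)
    (hT1b : ∀ t ∈ Set.Icc T1 T, s2 t ≤ s1 t)
    (α : ℝ) (hα : α ∈ Set.Ioo (0 : ℝ) 1)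
    (hΔ1 : ∀ t ∈ Set.Icc (0 : ℝ) T, |ts1 t - s1 t| ≤ α * (ts2 t - s2 t))
    (hinit : (ts2 0 - s2 0) / s2 0 ≤ (1 - α) / 72)
    (β : ℝ) (hβ : β = (2 : ℝ) ^ (-(3 * (p : ℝ) - 2) / p) * (1 - α)) :
    ∀ t : ℝ, 0 ≤ t → t ≤ T1 →
      ts2 t - s2 t ≤ ((ts2 0 - s2 0) / s2 0) * s2 t *
        (1 + (2 : ℝ) ^ (((p : ℝ) - 2) / p) * C0 * s2 0 ^ ((2 * (p : ℝ) - 4) / p) * t) ^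
          (-β) := by
  intro t ht0 htT1
  have hp3 : (3 : ℝ) ≤ p := by exact_mod_cast hp
  have hp0 : (0 : ℝ) < p := by linarith
  obtain ⟨e, he⟩ : ∃ e : ℝ, e = ((p : ℝ) - 2) / p := ⟨_, rfl⟩
  obtain ⟨K, hK⟩ : ∃ K : ℝ, K = Real.log lam * ((p : ℝ) / 2) ^ ((2 * (p : ℝ) - 4) / p) :=
    ⟨_, rfl⟩
  have he2 : (2 * (p : ℝ) - 4) / p = 2 * e := by rw [he]; ring
  have hexp : -(3 * (p : ℝ) - 2) / p = -e - 2 := by rw [he]; field_simp; ring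
  have he0 : 0 ≤ e := by rw [he]; exact div_nonneg (by linarith) hp0.le
  have he1 : e ≤ 1 := by rw [he, div_le_one hp0]; linarith
  have hK0 : 0 < K := by
    rw [hK]
    exact mul_pos (Real.log_pos hlam) (Real.rpow_pos_of_pos (by positivity) _)
  have hC0K : C0 = 2 * e * K := by rw [hC0, he2, hK, he2]; ring
  have hβe : β * 2 ^ e = (1 - α) / 4 := by
    have h2e : (2 : ℝ) ^ e ≠ 0 := (Real.rpow_pos_of_pos two_pos e).ne'
    rw [hβ, hexp, Real.rpow_sub two_pos, Real.rpow_neg two_pos.le, Real.rpow_two]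
    field_simp
    ring
  have hsub : Icc 0 T1 ⊆ Icc 0 T := Icc_subset_Icc_right hT1.2
  have h0 : (0 : ℝ) ∈ Icc 0 T1 := ⟨le_rfl, hT1.1⟩
  simp only [← hK, ← he] at hds2 hdts2
  rw [← he, he2, hC0K]
  have hβ0 : 0 ≤ β := by
    rw [hβ]
    exact mul_nonneg (Real.rpow_nonneg two_pos.le _) (by linarith [hα.2])
  have hratio : ∀ t ∈ Icc 0 T1, HasDerivWithinAt (fun t => ts2 t / s2 t - 1)
      (-(K * (ts2 t / s2 t *
        ((ts1 t ^ 2 + ts2 t ^ 2) ^ e - (s1 t ^ 2 + s2 t ^ 2) ^ e)))) (Icc 0 T1) t := by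
    intro t ht
    have hs := (hpos2 t (hsub ht)).ne'
    refine ((((hdts2 t (hsub ht)).mono hsub).div
      ((hds2 t (hsub ht)).mono hsub) hs).sub_const 1).congr_deriv ?_
    field_simp
    ring
  have hanti : AntitoneOn (fun t => ts2 t / s2 t - 1) (Icc 0 T1) := by
    refine antitoneOn_Icc_of_hasDerivWithinAt_nonpos hratio fun t ht => ?_
    have hs := hpos2 t (hsub ht)
    have hd := hΔ2 t (hsub ht)
    have hts : 0 < ts2 t := by linarith
    have hnorm := mul_sub_le_sq_add_sq_sub (hpos1 t (hsub ht)) (hT1a t ht)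
      (hΔ1 t (hsub ht))
    have hα' : 0 < 1 - α := sub_pos.mpr hα.2
    have hnn : 0 ≤ 2 * (1 - α) * s2 t * (ts2 t - s2 t) := by positivity
    have hpow : (s1 t ^ 2 + s2 t ^ 2) ^ e ≤ (ts1 t ^ 2 + ts2 t ^ 2) ^ e :=
      Real.rpow_le_rpow (by positivity) (by linarith) he0
    have hpow' := sub_nonneg.mpr hpow
    exact neg_nonpos.mpr (by positivity)
  have hsmall : ∀ t ∈ Icc 0 T1, ts2 t ≤ 2 * s2 t := by
    intro t ht
    have h := hanti h0 ht ht.1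
    rw [sub_div, div_self (hpos2 0 (hsub h0)).ne'] at hinit
    have hle : ts2 t / s2 t ≤ 2 := by
      have := hα.1
      simp only at h
      linarith
    rwa [div_le_iff₀ (hpos2 t (hsub ht))] at hle
  have hA : 0 ≤ 2 ^ e * (2 * e * K) * s2 0 ^ (2 * e) := by
    have := hpos2 0 (hsub h0)
    positivity
  have hmain := le_mul_one_add_mul_rpow_neg (β := β) hA hratio (fun t ht => by
    have hs := hpos2 t (hsub ht)
    have hd := hΔ2 t (hsub ht)
    have hlow := rpow_sq_add_sq_sub_lower_bound hα.2 he0 he1 (hpos1 t (hsub ht)) (hT1a t ht)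
      hd (hΔ1 t (hsub ht)) (hsmall t ht)
    have hdecay := rpow_div_le_rpow_of_slowdown hK0.le he0 (fun t ht => hpos1 t (hsub ht)) hT1a
      (fun t ht => (hds2 t (hsub ht)).mono hsub) ht
    have hχ : 0 ≤ ts2 t / s2 t - 1 := by
      rw [sub_nonneg, one_le_div hs]
      linarith
    have hc : 0 ≤ β * 2 ^ e * (2 * e * K) * (ts2 t / s2 t - 1) := by positivity
    have h1 := mul_le_mul_of_nonneg_left hdecay hc
    have h2 := mul_le_mul_of_nonneg_left hlow hK0.le
    linear_combination h1 + h2 +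
      2 * e * K * (ts2 t / s2 t - 1) * s2 t ^ (2 * e) * hβe) ⟨ht0, htT1⟩
  have hs := hpos2 t (hsub ⟨ht0, htT1⟩)
  have hm := mul_le_mul_of_nonneg_right hmain hs.le
  have hl : (ts2 t / s2 t - 1) * s2 t = ts2 t - s2 t := by field_simp
  have hr : (ts2 0 - s2 0) / s2 0 = ts2 0 / s2 0 - 1 := by
    rw [sub_div, div_self (hpos2 0 (hsub h0)).ne']
  rw [hr]
  linear_combination hm - hl
end

section
/- Under the two-solution hypotheses, for all T₁ ≤ t ≤ b ≤ T one has Δs₂(t) ≤ (Δs₂(T₁)/s₁(T₁))·s₁(t)·((1 + 2^{(p−2)/p}·C₀·s₁(b)^{(2p−4)/p}·(b−t)) / (1 + 2^{(p−2)/p}·C₀·s₁(b)^{(2p−4)/p}·(b−T₁)))^{β}. -/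
open Real Set

lemma mul_rpow_sub_rpow_le {γ u v : ℝ} (hγ : γ ≤ 1) (hu : 0 < u) (hv : 0 ≤ v) (hvu : v ≤ u) :
    u * (u ^ γ - v ^ γ) ≤ u ^ γ * (u - v) := by
  rcases hv.eq_or_lt with rfl | hv
  · have := mul_nonneg hu.le (rpow_nonneg (le_refl (0 : ℝ)) γ)
    linarith
  have h1 : u ^ γ * u ^ (1 - γ) = u := by rw [← rpow_add hu]; simp
  have h2 : v ^ γ * v ^ (1 - γ) = v := by rw [← rpow_add hv]; simp
  have h3 : v ^ (1 - γ) ≤ u ^ (1 - γ) := rpow_le_rpow hv.le hvu (by linarith)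
  have h4 := mul_le_mul_of_nonneg_left h3 (mul_pos (rpow_pos_of_pos hu γ) (rpow_pos_of_pos hv γ)).le
  calc u * (u ^ γ - v ^ γ) = u ^ γ * u - u ^ γ * v ^ γ * u ^ (1 - γ) := by
        linear_combination v ^ γ * h1
    _ ≤ u ^ γ * u - u ^ γ * v ^ γ * v ^ (1 - γ) := by linarith
    _ = u ^ γ * (u - v) := by linear_combination (-u ^ γ) * h2

/-- Lower bound on the rate at which the difference of the second coordinates, relative to the
first coordinate, contracts along the slowdown flow. -/
lemma slowdown_contraction_rate {γ α x y X Y : ℝ} (hγ0 : 0 ≤ γ) (hγ : γ ≤ 1) (hα : 0 ≤ α)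
    (hx : 0 < x) (hy : 0 < y) (hY : 0 < Y - y) (hX : |X - x| ≤ α * (Y - y)) :
    (1 - α) * (x ^ 2 + y ^ 2) ^ γ * (Y - y) ≤
      (x ^ 2 + y ^ 2) ^ γ * (Y - y) + (Y * (X ^ 2 + Y ^ 2) ^ γ - y * (x ^ 2 + y ^ 2) ^ γ) := by
  have hu : 0 < x ^ 2 + y ^ 2 := by positivity
  have hv : 0 ≤ X ^ 2 + Y ^ 2 := by positivity
  have hU := rpow_pos_of_pos hu γ
  have hV := rpow_nonneg hv γ
  have hVY := mul_nonneg hV hY.le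
  suffices h : y * ((x ^ 2 + y ^ 2) ^ γ - (X ^ 2 + Y ^ 2) ^ γ) ≤
      α * (x ^ 2 + y ^ 2) ^ γ * (Y - y) by linarith
  rcases le_total (x ^ 2 + y ^ 2) (X ^ 2 + Y ^ 2) with huv | huv
  · have h1 := rpow_le_rpow hu.le huv hγ0
    exact (mul_nonpos_of_nonneg_of_nonpos hy.le (by linarith)).trans (by positivity)
  · have h1 := mul_rpow_sub_rpow_le hγ hu hv huv
    have h2 : y * (x ^ 2 + y ^ 2 - (X ^ 2 + Y ^ 2)) ≤ α * (x ^ 2 + y ^ 2) * (Y - y) := by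
      have h3 : -(X - x) ≤ α * (Y - y) := (neg_le_abs _).trans hX
      have h4 := mul_le_mul_of_nonneg_left h3 (mul_pos hx hy).le
      have h5 : 0 ≤ α * (Y - y) * (x - y) ^ 2 := by positivity
      have h6 : 0 ≤ y * ((X - x) ^ 2 + (Y - y) ^ 2) := by positivity
      have h7 : 0 ≤ y ^ 2 * (Y - y) := by positivity
      linarith
    have h3 := mul_le_mul_of_nonneg_left h1 hy.le
    have h4 := mul_le_mul_of_nonneg_left h2 hU.le
    refine le_of_mul_le_mul_left ?_ hu
    linarith

/-- A positive function growing at rate at most `c f (2 f²) ^ γ` is bounded below in terms of its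
value at the right endpoint. -/
lemma rpow_endpoint_div_le_rpow {γ c a b : ℝ} (hγ : 0 < γ) (hc : 0 ≤ c) {f g : ℝ → ℝ}
    (hf : ∀ t ∈ Icc a b, HasDerivWithinAt f (c * f t * (f t ^ 2 + g t ^ 2) ^ γ) (Icc a b) t)
    (hf0 : ∀ t ∈ Icc a b, 0 < f t) (hg0 : ∀ t ∈ Icc a b, 0 ≤ g t)
    (hgf : ∀ t ∈ Icc a b, g t ≤ f t) {t : ℝ} (ht : t ∈ Icc a b) :
    f b ^ (2 * γ) / (1 + 2 ^ γ * (2 * γ * c) * f b ^ (2 * γ) * (b - t)) ≤ f t ^ (2 * γ) := by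
  set M : ℝ := 2 ^ γ * (2 * γ * c)
  have hb : b ∈ Icc a b := ⟨ht.1.trans ht.2, le_rfl⟩
  have hmono : MonotoneOn (fun t ↦ f t ^ (-(2 * γ)) + M * t) (Icc a b) := by
    have hd : ∀ t ∈ Icc a b, HasDerivWithinAt (fun t ↦ f t ^ (-(2 * γ)) + M * t)
        (c * f t * (f t ^ 2 + g t ^ 2) ^ γ * (-(2 * γ)) * f t ^ (-(2 * γ) - 1) + M * 1)
        (Icc a b) t := fun t ht ↦
      ((hf t ht).rpow_const (Or.inl (hf0 t ht).ne')).add ((hasDerivWithinAt_id t _).const_mul M)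
    refine monotoneOn_of_hasDerivWithinAt_nonneg (convex_Icc a b)
      (fun t ht ↦ (hd t ht).continuousWithinAt)
      (fun t ht ↦ (hd t (interior_subset ht)).mono interior_subset) fun t ht ↦ ?_
    have ht' := interior_subset ht
    have hft := hf0 t ht'
    have hle : (f t ^ 2 + g t ^ 2) ^ γ ≤ 2 ^ γ * f t ^ (2 * γ) := by
      calc (f t ^ 2 + g t ^ 2) ^ γ ≤ (2 * f t ^ 2) ^ γ := by
            refine rpow_le_rpow (by positivity) ?_ hγ.le
            nlinarith [hg0 t ht', hgf t ht']
        _ = 2 ^ γ * f t ^ (2 * γ) := by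
            rw [mul_rpow (by norm_num) (by positivity), rpow_mul hft.le, rpow_two]
    have h1 : f t * f t ^ (-(2 * γ) - 1) = f t ^ (-(2 * γ)) := by
      rw [rpow_sub_one hft.ne']; field_simp
    have h2 : f t ^ (2 * γ) * f t ^ (-(2 * γ)) = 1 := by
      rw [← rpow_add hft]; simp
    have h3 := mul_le_mul_of_nonneg_left hle
      (show 0 ≤ c * (2 * γ) * f t ^ (-(2 * γ)) by positivity)
    have h4 : c * (2 * γ) * f t ^ (-(2 * γ)) * (2 ^ γ * f t ^ (2 * γ)) = M := by
      linear_combination c * (2 * γ) * 2 ^ γ * h2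
    have h5 : c * f t * (f t ^ 2 + g t ^ 2) ^ γ * (-(2 * γ)) * f t ^ (-(2 * γ) - 1) =
        -(c * (2 * γ) * f t ^ (-(2 * γ)) * (f t ^ 2 + g t ^ 2) ^ γ) := by
      linear_combination (-(c * (2 * γ) * (f t ^ 2 + g t ^ 2) ^ γ)) * h1
    linarith
  have h := hmono ht hb ht.2
  simp only [rpow_neg (hf0 t ht).le, rpow_neg (hf0 b hb).le] at h
  have hA := rpow_pos_of_pos (hf0 t ht) (2 * γ)
  have hB := rpow_pos_of_pos (hf0 b hb) (2 * γ)
  have hM : 0 ≤ M := by positivity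
  have htb : 0 ≤ b - t := sub_nonneg.2 ht.2
  have hden : 0 < 1 + M * f b ^ (2 * γ) * (b - t) := by positivity
  rw [div_le_iff₀ hden]
  have h' : (f t ^ (2 * γ))⁻¹ ≤ (f b ^ (2 * γ))⁻¹ + M * (b - t) := by linarith
  have h'' := mul_le_mul_of_nonneg_left h' (mul_pos hA hB).le
  have e1 : f t ^ (2 * γ) * f b ^ (2 * γ) * (f t ^ (2 * γ))⁻¹ = f b ^ (2 * γ) := by field_simp
  have e2 : f t ^ (2 * γ) * f b ^ (2 * γ) * ((f b ^ (2 * γ))⁻¹ + M * (b - t)) =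
      f t ^ (2 * γ) * (1 + M * f b ^ (2 * γ) * (b - t)) := by field_simp
  linarith

/-- Comparison of two solutions of the slowdown system with rate `c` and exponent `γ`. -/
lemma slowdown_difference_le {γ c α β a b : ℝ} (hγ0 : 0 < γ) (hγ1 : γ ≤ 1) (hc : 0 ≤ c)
    (hα : α ∈ Ioo (0 : ℝ) 1) (hβ : β * 2 ^ γ = (1 - α) / 4) {x y X Y : ℝ → ℝ}
    (hx : ∀ t ∈ Icc a b, HasDerivWithinAt x (c * x t * (x t ^ 2 + y t ^ 2) ^ γ) (Icc a b) t)
    (hy : ∀ t ∈ Icc a b, HasDerivWithinAt y (-(c * y t * (x t ^ 2 + y t ^ 2) ^ γ)) (Icc a b) t)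
    (hY : ∀ t ∈ Icc a b, HasDerivWithinAt Y (-(c * Y t * (X t ^ 2 + Y t ^ 2) ^ γ)) (Icc a b) t)
    (hx0 : ∀ t ∈ Icc a b, 0 < x t) (hy0 : ∀ t ∈ Icc a b, 0 < y t)
    (hyx : ∀ t ∈ Icc a b, y t ≤ x t) (hD : ∀ t ∈ Icc a b, 0 < Y t - y t)
    (hE : ∀ t ∈ Icc a b, |X t - x t| ≤ α * (Y t - y t)) {t : ℝ} (ht : t ∈ Icc a b) :
    Y t - y t ≤ (Y a - y a) / x a * x t *
      ((1 + 2 ^ γ * (2 * γ * c) * x b ^ (2 * γ) * (b - t)) /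
        (1 + 2 ^ γ * (2 * γ * c) * x b ^ (2 * γ) * (b - a))) ^ β := by
  have ha : a ∈ Icc a b := ⟨le_rfl, ht.1.trans ht.2⟩
  have hb : b ∈ Icc a b := ⟨ht.1.trans ht.2, le_rfl⟩
  set K : ℝ := 2 ^ γ * (2 * γ * c) * x b ^ (2 * γ) with hK
  have hK0 : 0 ≤ K := by have := rpow_pos_of_pos (hx0 b hb) (2 * γ); positivity
  have hden : ∀ t ∈ Icc a b, 0 < 1 + K * (b - t) := fun t ht ↦ by
    have : 0 ≤ b - t := sub_nonneg.2 ht.2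
    positivity
  have hanti : AntitoneOn
      (fun t ↦ log (Y t - y t) - log (x t) - β * log (1 + K * (b - t))) (Icc a b) := by
    have hd : ∀ t ∈ Icc a b, HasDerivWithinAt
        (fun t ↦ log (Y t - y t) - log (x t) - β * log (1 + K * (b - t)))
        ((-(c * Y t * (X t ^ 2 + Y t ^ 2) ^ γ) - -(c * y t * (x t ^ 2 + y t ^ 2) ^ γ)) /
          (Y t - y t) - c * x t * (x t ^ 2 + y t ^ 2) ^ γ / x t -
          β * (K * -1 / (1 + K * (b - t)))) (Icc a b) t := fun t ht ↦
      ((((hY t ht).sub (hy t ht)).log (hD t ht).ne').sub ((hx t ht).log (hx0 t ht).ne')).sub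
        (((((hasDerivWithinAt_id t _).const_sub b).const_mul K).const_add 1).log
          (hden t ht).ne' |>.const_mul β)
    refine antitoneOn_of_hasDerivWithinAt_nonpos (convex_Icc a b)
      (fun t ht ↦ (hd t ht).continuousWithinAt)
      (fun t ht ↦ (hd t (interior_subset ht)).mono interior_subset) fun t ht ↦ ?_
    have ht' := interior_subset ht
    have hxt := hx0 t ht'
    have hDt := hD t ht'
    have hrate := slowdown_contraction_rate hγ0.le hγ1 hα.1.le hxt (hy0 t ht') hDt (hE t ht')
    have hend := rpow_endpoint_div_le_rpow hγ0 hc hx hx0 (fun t ht ↦ (hy0 t ht).le) hyx ht'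
    have hpow : x t ^ (2 * γ) ≤ (x t ^ 2 + y t ^ 2) ^ γ := by
      rw [rpow_mul hxt.le, rpow_two]
      exact rpow_le_rpow (by positivity) (by nlinarith [sq_nonneg (y t)]) hγ0.le
    set U := (x t ^ 2 + y t ^ 2) ^ γ
    set V := (X t ^ 2 + Y t ^ 2) ^ γ
    have hU : 0 ≤ U := (rpow_pos_of_pos hxt _).le.trans hpow
    have h1α : 0 < 1 - α := sub_pos.2 hα.2
    have h1 : (-(c * Y t * V) - -(c * y t * U)) / (Y t - y t) ≤ c * U - c * ((1 - α) * U) := by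
      rw [div_le_iff₀ hDt]
      linarith [mul_le_mul_of_nonneg_left hrate hc]
    have h2 : c * x t * U / x t = c * U := by field_simp
    have h3 : β * (K * -1 / (1 + K * (b - t))) =
        -((1 - α) / 4 * (2 * γ * c) * (x b ^ (2 * γ) / (1 + K * (b - t)))) := by
      rw [← hβ, hK]; ring
    have h4 := mul_le_mul_of_nonneg_left (hend.trans hpow)
      (show 0 ≤ (1 - α) / 4 * (2 * γ * c) by positivity)
    have h5 : (1 - α) / 4 * (2 * γ * c) * U ≤ c * ((1 - α) * U) := by
      have : 0 ≤ c * (1 - α) * U := by positivity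
      nlinarith
    rw [h2, h3]
    linarith
  have h := hanti ha ht ht.1
  have hDa := hD a ha
  have hDt := hD t ht
  have hxa := hx0 a ha
  have hxt := hx0 t ht
  have hna := hden a ha
  have hnt := hden t ht
  rw [← log_le_log_iff hDt (by positivity), log_mul (by positivity) (by positivity),
    log_mul (by positivity) hxt.ne', log_div hDa.ne' hxa.ne', log_rpow (by positivity),
    log_div hnt.ne' hna.ne']
  simp only at h
  linarith

/-- Under the two-solution hypotheses, for `T₁ ≤ t ≤ b ≤ T`,
`Δs₂(t) ≤ (Δs₂(T₁)/s₁(T₁))·s₁(t)·((1 + 2^{(p−2)/p}·C₀·s₁(b)^{(2p−4)/p}·(b−t)) /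
(1 + 2^{(p−2)/p}·C₀·s₁(b)^{(2p−4)/p}·(b−T₁)))^{β}`. -/
theorem spread_in_slowdown_second
    (p : ℕ) (hp : 3 ≤ p) (lam : ℝ) (hlam : 1 < lam)
    (r0 r1 : ℝ) (hr1 : 0 < r1) (hr01 : r1 < r0)
    (rt1 : ℝ) (hrt1 : rt1 = (2 / (p : ℝ)) * r1 ^ ((p : ℝ) / 2))
    (C0 : ℝ)
    (hC0 : C0 = ((2 * (p : ℝ) - 4) / p) * ((p : ℝ) / 2) ^ ((2 * (p : ℝ) - 4) / p) *
      Real.log lam)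
    (T T1 : ℝ) (hT1 : T1 ∈ Set.Icc (0 : ℝ) T)
    (s1 s2 ts1 ts2 : ℝ → ℝ)
    (hds1 : ∀ t ∈ Set.Icc (0 : ℝ) T, HasDerivWithinAt s1
      (Real.log lam * ((p : ℝ) / 2) ^ ((2 * (p : ℝ) - 4) / p) * s1 t *
        (s1 t ^ 2 + s2 t ^ 2) ^ (((p : ℝ) - 2) / p)) (Set.Icc 0 T) t)
    (hds2 : ∀ t ∈ Set.Icc (0 : ℝ) T, HasDerivWithinAt s2
      (-(Real.log lam * ((p : ℝ) / 2) ^ ((2 * (p : ℝ) - 4) / p) * s2 t *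
        (s1 t ^ 2 + s2 t ^ 2) ^ (((p : ℝ) - 2) / p))) (Set.Icc 0 T) t)
    (hdts1 : ∀ t ∈ Set.Icc (0 : ℝ) T, HasDerivWithinAt ts1
      (Real.log lam * ((p : ℝ) / 2) ^ ((2 * (p : ℝ) - 4) / p) * ts1 t *
        (ts1 t ^ 2 + ts2 t ^ 2) ^ (((p : ℝ) - 2) / p)) (Set.Icc 0 T) t)
    (hdts2 : ∀ t ∈ Set.Icc (0 : ℝ) T, HasDerivWithinAt ts2
      (-(Real.log lam * ((p : ℝ) / 2) ^ ((2 * (p : ℝ) - 4) / p) * ts2 t *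
        (ts1 t ^ 2 + ts2 t ^ 2) ^ (((p : ℝ) - 2) / p))) (Set.Icc 0 T) t)
    (hpos1 : ∀ t ∈ Set.Icc (0 : ℝ) T, 0 < s1 t)
    (hpos2 : ∀ t ∈ Set.Icc (0 : ℝ) T, 0 < s2 t)
    (hdisc : ∀ t ∈ Set.Icc (0 : ℝ) T, s1 t ^ 2 + s2 t ^ 2 ≤ rt1 ^ 2)
    (hdisc' : ∀ t ∈ Set.Icc (0 : ℝ) T, ts1 t ^ 2 + ts2 t ^ 2 ≤ rt1 ^ 2)
    (hΔ2 : ∀ t ∈ Set.Icc (0 : ℝ) T, 0 < ts2 t - s2 t)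
    (hT1a : ∀ t ∈ Set.Icc (0 : ℝ) T1, s1 t ≤ s2 t)
    (hT1b : ∀ t ∈ Set.Icc T1 T, s2 t ≤ s1 t)
    (α : ℝ) (hα : α ∈ Set.Ioo (0 : ℝ) 1)
    (hΔ1 : ∀ t ∈ Set.Icc (0 : ℝ) T, |ts1 t - s1 t| ≤ α * (ts2 t - s2 t))
    (hinit : (ts2 0 - s2 0) / s2 0 ≤ (1 - α) / 72)
    (β : ℝ) (hβ : β = (2 : ℝ) ^ (-(3 * (p : ℝ) - 2) / p) * (1 - α)) :
    ∀ t b : ℝ, T1 ≤ t → t ≤ b → b ≤ T →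
      ts2 t - s2 t ≤ ((ts2 T1 - s2 T1) / s1 T1) * s1 t *
        ((1 + (2 : ℝ) ^ (((p : ℝ) - 2) / p) * C0 * s1 b ^ ((2 * (p : ℝ) - 4) / p) *
            (b - t)) /
          (1 + (2 : ℝ) ^ (((p : ℝ) - 2) / p) * C0 * s1 b ^ ((2 * (p : ℝ) - 4) / p) *
            (b - T1))) ^ β := by
  intro t b ht htb hb
  have hp' : (3 : ℝ) ≤ p := by exact_mod_cast hp
  have hp0 : (0 : ℝ) < p := by linarith
  have hsub : Icc T1 b ⊆ Icc 0 T := Icc_subset_Icc hT1.1 hb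
  have hexp : (2 * (p : ℝ) - 4) / p = 2 * (((p : ℝ) - 2) / p) := by ring
  have hC0' : C0 = 2 * (((p : ℝ) - 2) / p) *
      (log lam * ((p : ℝ) / 2) ^ ((2 * (p : ℝ) - 4) / p)) := by
    rw [hC0, ← hexp]; ring
  have hβ' : β * 2 ^ (((p : ℝ) - 2) / p) = (1 - α) / 4 := by
    have h : (2 : ℝ) ^ (-(3 * (p : ℝ) - 2) / p) * 2 ^ (((p : ℝ) - 2) / p) = 1 / 4 := by
      rw [← rpow_add two_pos, show -(3 * (p : ℝ) - 2) / p + ((p : ℝ) - 2) / p = -2 by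
        field_simp; ring, rpow_neg two_pos.le]
      norm_num
    rw [hβ]
    linear_combination (1 - α) * h
  have hlog := log_pos hlam
  rw [hC0', show s1 b ^ ((2 * (p : ℝ) - 4) / p) = s1 b ^ (2 * (((p : ℝ) - 2) / p)) by rw [hexp]]
  exact slowdown_difference_le (div_pos (by linarith) hp0) ((div_le_one hp0).2 (by linarith))
    (by positivity) hα hβ' (fun t ht ↦ (hds1 t (hsub ht)).mono hsub)
    (fun t ht ↦ (hds2 t (hsub ht)).mono hsub) (fun t ht ↦ (hdts2 t (hsub ht)).mono hsub)
    (fun t ht ↦ hpos1 t (hsub ht)) (fun t ht ↦ hpos2 t (hsub ht))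
    (fun t ht ↦ hT1b t ⟨ht.1, ht.2.trans hb⟩) (fun t ht ↦ hΔ2 t (hsub ht))
    (fun t ht ↦ hΔ1 t (hsub ht)) ⟨ht, htb⟩
end

section
/- Under the two-solution hypotheses, for all 0 ≤ a ≤ T₁ ≤ b ≤ T one has ‖Δs(b)‖ ≤ √(1+α²)·(s₁(b)/s₂(a))·‖Δs(a)‖, where ‖Δs(t)‖ denotes the Euclidean norm of (Δs₁(t), Δs₂(t)). -/
open Real Set

/-- If `f' g ≤ f g'` and `g > 0` on `[c, d]`, then `f / g` does not increase from `c` to `d`. -/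
theorem div_le_div_of_deriv_mul_le {f g f' g' : ℝ → ℝ} {c d : ℝ} (hcd : c ≤ d)
    (hf : ∀ t ∈ Icc c d, HasDerivWithinAt f (f' t) (Icc c d) t)
    (hg : ∀ t ∈ Icc c d, HasDerivWithinAt g (g' t) (Icc c d) t)
    (hpos : ∀ t ∈ Icc c d, 0 < g t)
    (hle : ∀ t ∈ Icc c d, f' t * g t ≤ f t * g' t) :
    f d / g d ≤ f c / g c := by
  have hder : ∀ t ∈ Icc c d, HasDerivWithinAt (fun t => f t / g t)
      ((f' t * g t - f t * g' t) / g t ^ 2) (Icc c d) t := fun t ht =>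
    (hf t ht).div (hg t ht) (hpos t ht).ne'
  have hanti : AntitoneOn (fun t => f t / g t) (Icc c d) := by
    refine antitoneOn_of_hasDerivWithinAt_nonpos (convex_Icc c d)
      (fun t ht => (hder t ht).continuousWithinAt)
      (fun t ht => (hder t (interior_subset ht)).mono interior_subset) fun t ht => ?_
    exact div_nonpos_of_nonpos_of_nonneg (sub_nonpos.2 (hle t (interior_subset ht)))
      (sq_nonneg _)
  exact hanti (left_mem_Icc.2 hcd) (right_mem_Icc.2 hcd) hcd

theorem sq_add_sq_le_of_abs_sub_le {x y X Y : ℝ} (hx : 0 < x) (hxy : x ≤ y)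
    (h : |X - x| ≤ Y - y) : x ^ 2 + y ^ 2 ≤ X ^ 2 + Y ^ 2 := by
  obtain ⟨h1, -⟩ := abs_le.1 h
  have hη : 0 ≤ Y - y := (abs_nonneg _).trans h
  nlinarith [sq_nonneg (X - x), sq_nonneg (Y - y), mul_nonneg hη (sub_nonneg.2 hxy),
    mul_le_mul_of_nonneg_left h1 hx.le]

theorem two_mul_le_of_abs_sub_le {x y X Y : ℝ} (hx : 0 < x) (hy : 0 < y)
    (h : |X - x| ≤ Y - y) :
    2 * y * (x ^ 2 + y ^ 2) ≤ Y * ((X ^ 2 + Y ^ 2) + (x ^ 2 + y ^ 2)) := by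
  obtain ⟨h1, -⟩ := abs_le.1 h
  have hη : 0 ≤ Y - y := (abs_nonneg _).trans h
  have hY : 0 ≤ Y := by linarith
  have hD : (Y - y) * (y + Y - 2 * x) ≤ X ^ 2 + Y ^ 2 - (x ^ 2 + y ^ 2) := by
    nlinarith [sq_nonneg (X - x), mul_le_mul_of_nonneg_left h1 hx.le]
  have hq : 0 ≤ 2 * (x ^ 2 + y ^ 2) + Y * (y + Y - 2 * x) := by
    nlinarith [sq_nonneg (Y - x), mul_nonneg hY hy.le, sq_nonneg x, sq_nonneg y]
  nlinarith [mul_le_mul_of_nonneg_left hD hY, mul_nonneg hη hq]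

/-- Concavity of `· ^ q`, in the form that `U ^ q / U` is nonincreasing. -/
theorem mul_rpow_le_mul_rpow {U u q : ℝ} (hU : 0 < U) (hUu : U ≤ u) (hq : q ≤ 1) :
    U * u ^ q ≤ u * U ^ q := by
  have hu : 0 < u := hU.trans_le hUu
  have h := Real.rpow_le_rpow_of_exponent_ge (div_pos hU hu) ((div_le_one hu).2 hUu) hq
  rw [Real.rpow_one, Real.div_rpow hU.le hu.le,
    div_le_div_iff₀ hu (Real.rpow_pos_of_pos hu q)] at h
  linarith

theorem two_mul_rpow_le_of_abs_sub_le {x y X Y q : ℝ} (hx : 0 < x) (hy : 0 < y)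
    (h : |X - x| ≤ Y - y) (hq0 : 0 ≤ q) (hq1 : q ≤ 1) :
    2 * y * (x ^ 2 + y ^ 2) ^ q ≤ Y * ((X ^ 2 + Y ^ 2) ^ q + (x ^ 2 + y ^ 2) ^ q) := by
  have hyY : y ≤ Y := sub_nonneg.1 ((abs_nonneg _).trans h)
  have hY : 0 < Y := hy.trans_le hyY
  have hmain := two_mul_le_of_abs_sub_le hx hy h
  have hu : 0 < x ^ 2 + y ^ 2 := by positivity
  have hU : 0 < X ^ 2 + Y ^ 2 := by positivity
  set u := x ^ 2 + y ^ 2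
  set U := X ^ 2 + Y ^ 2
  have huq : 0 < u ^ q := Real.rpow_pos_of_pos hu q
  rcases le_total u U with huU | hUu
  · have hm : u ^ q ≤ U ^ q := Real.rpow_le_rpow hu.le huU hq0
    nlinarith [mul_le_mul_of_nonneg_left hm hY.le, mul_le_mul_of_nonneg_right hyY huq.le]
  · refine le_of_mul_le_mul_left ?_ hu
    nlinarith [mul_le_mul_of_nonneg_left (mul_rpow_le_mul_rpow hU hUu hq1) hY.le,
      mul_le_mul_of_nonneg_right hmain huq.le]

/-- Under the two-solution hypotheses, for `0 ≤ a ≤ T₁ ≤ b ≤ T`,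
`‖Δs(b)‖ ≤ √(1+α²)·(s₁(b)/s₂(a))·‖Δs(a)‖`. -/
theorem deviation_bound
    (p : ℕ) (hp : 3 ≤ p) (lam : ℝ) (hlam : 1 < lam)
    (r0 r1 : ℝ) (hr1 : 0 < r1) (hr01 : r1 < r0)
    (rt1 : ℝ) (hrt1 : rt1 = (2 / (p : ℝ)) * r1 ^ ((p : ℝ) / 2))
    (C0 : ℝ)
    (hC0 : C0 = ((2 * (p : ℝ) - 4) / p) * ((p : ℝ) / 2) ^ ((2 * (p : ℝ) - 4) / p) *
      Real.log lam)
    (T T1 : ℝ) (hT1 : T1 ∈ Set.Icc (0 : ℝ) T)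
    (s1 s2 ts1 ts2 : ℝ → ℝ)
    (hds1 : ∀ t ∈ Set.Icc (0 : ℝ) T, HasDerivWithinAt s1
      (Real.log lam * ((p : ℝ) / 2) ^ ((2 * (p : ℝ) - 4) / p) * s1 t *
        (s1 t ^ 2 + s2 t ^ 2) ^ (((p : ℝ) - 2) / p)) (Set.Icc 0 T) t)
    (hds2 : ∀ t ∈ Set.Icc (0 : ℝ) T, HasDerivWithinAt s2
      (-(Real.log lam * ((p : ℝ) / 2) ^ ((2 * (p : ℝ) - 4) / p) * s2 t *
        (s1 t ^ 2 + s2 t ^ 2) ^ (((p : ℝ) - 2) / p))) (Set.Icc 0 T) t)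
    (hdts1 : ∀ t ∈ Set.Icc (0 : ℝ) T, HasDerivWithinAt ts1
      (Real.log lam * ((p : ℝ) / 2) ^ ((2 * (p : ℝ) - 4) / p) * ts1 t *
        (ts1 t ^ 2 + ts2 t ^ 2) ^ (((p : ℝ) - 2) / p)) (Set.Icc 0 T) t)
    (hdts2 : ∀ t ∈ Set.Icc (0 : ℝ) T, HasDerivWithinAt ts2
      (-(Real.log lam * ((p : ℝ) / 2) ^ ((2 * (p : ℝ) - 4) / p) * ts2 t *
        (ts1 t ^ 2 + ts2 t ^ 2) ^ (((p : ℝ) - 2) / p))) (Set.Icc 0 T) t)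
    (hpos1 : ∀ t ∈ Set.Icc (0 : ℝ) T, 0 < s1 t)
    (hpos2 : ∀ t ∈ Set.Icc (0 : ℝ) T, 0 < s2 t)
    (hdisc : ∀ t ∈ Set.Icc (0 : ℝ) T, s1 t ^ 2 + s2 t ^ 2 ≤ rt1 ^ 2)
    (hdisc' : ∀ t ∈ Set.Icc (0 : ℝ) T, ts1 t ^ 2 + ts2 t ^ 2 ≤ rt1 ^ 2)
    (hΔ2 : ∀ t ∈ Set.Icc (0 : ℝ) T, 0 < ts2 t - s2 t)
    (hT1a : ∀ t ∈ Set.Icc (0 : ℝ) T1, s1 t ≤ s2 t)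
    (hT1b : ∀ t ∈ Set.Icc T1 T, s2 t ≤ s1 t)
    (α : ℝ) (hα : α ∈ Set.Ioo (0 : ℝ) 1)
    (hΔ1 : ∀ t ∈ Set.Icc (0 : ℝ) T, |ts1 t - s1 t| ≤ α * (ts2 t - s2 t))
    (hinit : (ts2 0 - s2 0) / s2 0 ≤ (1 - α) / 72)
    (β : ℝ) (hβ : β = (2 : ℝ) ^ (-(3 * (p : ℝ) - 2) / p) * (1 - α)) :
    ∀ a b : ℝ, 0 ≤ a → a ≤ T1 → T1 ≤ b → b ≤ T →
      Real.sqrt ((ts1 b - s1 b) ^ 2 + (ts2 b - s2 b) ^ 2) ≤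
        Real.sqrt (1 + α ^ 2) * (s1 b / s2 a) *
          Real.sqrt ((ts1 a - s1 a) ^ 2 + (ts2 a - s2 a) ^ 2) := by
  intro a b ha haT hTb hb
  have hp3 : (3 : ℝ) ≤ p := by exact_mod_cast hp
  have hp0 : (0 : ℝ) < p := by linarith
  have hq0 : 0 ≤ ((p : ℝ) - 2) / p := div_nonneg (by linarith) hp0.le
  have hq1 : ((p : ℝ) - 2) / p ≤ 1 := (div_le_one hp0).2 (by linarith)
  have hk : 0 ≤ Real.log lam * ((p : ℝ) / 2) ^ ((2 * (p : ℝ) - 4) / p) :=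
    mul_nonneg (Real.log_nonneg hlam.le) (Real.rpow_nonneg (by positivity) _)
  set q := ((p : ℝ) - 2) / p
  set k := Real.log lam * ((p : ℝ) / 2) ^ ((2 * (p : ℝ) - 4) / p)
  obtain ⟨hT10, hT1T⟩ := hT1
  have hcone : ∀ t ∈ Icc (0 : ℝ) T, |ts1 t - s1 t| ≤ ts2 t - s2 t := fun t ht =>
    (hΔ1 t ht).trans (mul_le_of_le_one_left (hΔ2 t ht).le hα.2.le)
  have hcontract : (ts2 T1 - s2 T1) / s2 T1 ≤ (ts2 a - s2 a) / s2 a := by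
    have hsub : Icc a T1 ⊆ Icc 0 T := Icc_subset_Icc ha hT1T
    refine div_le_div_of_deriv_mul_le (f := fun t => ts2 t - s2 t) haT
      (fun t ht => ((hdts2 t (hsub ht)).sub (hds2 t (hsub ht))).mono hsub)
      (fun t ht => (hds2 t (hsub ht)).mono hsub) (fun t ht => hpos2 t (hsub ht)) fun t ht => ?_
    have hx := hpos1 t (hsub ht)
    have hy := hpos2 t (hsub ht)
    have hY : 0 < ts2 t := by linarith [hΔ2 t (hsub ht)]
    have hm : (s1 t ^ 2 + s2 t ^ 2) ^ q ≤ (ts1 t ^ 2 + ts2 t ^ 2) ^ q :=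
      Real.rpow_le_rpow (by positivity) (sq_add_sq_le_of_abs_sub_le hx
        (hT1a t ⟨ha.trans ht.1, ht.2⟩) (hcone t (hsub ht))) hq0
    linarith [mul_nonneg (mul_nonneg (mul_nonneg hk hy.le) hY.le) (sub_nonneg.2 hm)]
  have hexpand : (ts2 b - s2 b) / s1 b ≤ (ts2 T1 - s2 T1) / s1 T1 := by
    have hsub : Icc T1 b ⊆ Icc 0 T := Icc_subset_Icc hT10 hb
    refine div_le_div_of_deriv_mul_le (f := fun t => ts2 t - s2 t) hTb
      (fun t ht => ((hdts2 t (hsub ht)).sub (hds2 t (hsub ht))).mono hsub)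
      (fun t ht => (hds1 t (hsub ht)).mono hsub) (fun t ht => hpos1 t (hsub ht)) fun t ht => ?_
    have hx := hpos1 t (hsub ht)
    have hm := two_mul_rpow_le_of_abs_sub_le hx (hpos2 t (hsub ht)) (hcone t (hsub ht)) hq0 hq1
    linarith [mul_nonneg (mul_nonneg hk hx.le) (sub_nonneg.2 hm)]
  have hdiag : s1 T1 = s2 T1 :=
    le_antisymm (hT1a T1 ⟨hT10, le_rfl⟩) (hT1b T1 ⟨le_rfl, hT1T⟩)
  have ha' : a ∈ Icc (0 : ℝ) T := ⟨ha, haT.trans hT1T⟩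
  have hb' : b ∈ Icc (0 : ℝ) T := ⟨hT10.trans hTb, hb⟩
  have hx := hpos1 b hb'
  have hy := hpos2 a ha'
  have hηb := hΔ2 b hb'
  have hη : ts2 b - s2 b ≤ s1 b / s2 a * (ts2 a - s2 a) := by
    rw [hdiag] at hexpand
    calc ts2 b - s2 b ≤ (ts2 a - s2 a) / s2 a * s1 b :=
          (div_le_iff₀ hx).1 (hexpand.trans hcontract)
      _ = s1 b / s2 a * (ts2 a - s2 a) := by ring
  have hnb : Real.sqrt ((ts1 b - s1 b) ^ 2 + (ts2 b - s2 b) ^ 2) ≤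
      Real.sqrt (1 + α ^ 2) * (ts2 b - s2 b) := by
    refine Real.sqrt_le_iff.2 ⟨by positivity, ?_⟩
    rw [mul_pow, Real.sq_sqrt (by positivity)]
    obtain ⟨hl, hr⟩ := abs_le.1 (hΔ1 b hb')
    have h := sq_le_sq' hl hr
    linarith
  have hna : ts2 a - s2 a ≤ Real.sqrt ((ts1 a - s1 a) ^ 2 + (ts2 a - s2 a) ^ 2) :=
    Real.le_sqrt_of_sq_le (le_add_of_nonneg_left (sq_nonneg _))
  calc Real.sqrt ((ts1 b - s1 b) ^ 2 + (ts2 b - s2 b) ^ 2)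
      ≤ Real.sqrt (1 + α ^ 2) * (s1 b / s2 a * (ts2 a - s2 a)) :=
        hnb.trans (mul_le_mul_of_nonneg_left hη (Real.sqrt_nonneg _))
    _ ≤ Real.sqrt (1 + α ^ 2) * (s1 b / s2 a *
          Real.sqrt ((ts1 a - s1 a) ^ 2 + (ts2 a - s2 a) ^ 2)) := by gcongr
    _ = _ := (mul_assoc _ _ _).symm
end

section
/- Assume in addition that Ψₚ′ is nonincreasing on (0, r̃₀²]. Then for every u with 0 < u ≤ r̃₀² one has Ψₚ(u) ≥ (p/(p−2))·(r̃₁/r̃₀)²·u·Ψₚ′(u). -/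
open Real Set

/-- A differentiable function that equals `K * u ^ a` on `[0, s]` satisfies
`u * f' u = a * f u` on `(0, s]`, including at the right endpoint. -/
theorem mul_deriv_eq_of_eq_rpow_on_Icc {f : ℝ → ℝ} {K a s u : ℝ}
    (hf : ∀ x ∈ Set.Icc (0 : ℝ) s, f x = K * x ^ a)
    (hu : 0 < u) (hus : u ≤ s) (hd : DifferentiableAt ℝ f u) :
    u * deriv f u = a * f u := by
  have hmem : u ∈ Set.Icc (0 : ℝ) s := ⟨hu.le, hus⟩
  have hpow : HasDerivWithinAt f (K * (a * u ^ (a - 1))) (Set.Icc 0 s) u :=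
    ((Real.hasDerivAt_rpow_const (Or.inl hu.ne')).const_mul K).hasDerivWithinAt.congr
      hf (hf u hmem)
  have hderiv : deriv f u = K * (a * u ^ (a - 1)) :=
    (uniqueDiffOn_Icc (hu.trans_le hus) u hmem).eq_deriv _
      hd.hasDerivAt.hasDerivWithinAt hpow
  rw [hderiv, hf u hmem, Real.rpow_sub_one hu.ne']
  field_simp

/-- A function with nonnegative derivative on `(0, ∞)` is monotone there. -/
theorem monotoneOn_Ioi_of_deriv_nonneg_s12 {f : ℝ → ℝ}
    (hd : ∀ x : ℝ, 0 < x → DifferentiableAt ℝ f x)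
    (hf : ∀ x : ℝ, 0 < x → 0 ≤ deriv f x) : MonotoneOn f (Set.Ioi 0) := by
  refine monotoneOn_of_deriv_nonneg (convex_Ioi 0)
    (fun x hx => (hd x hx).continuousAt.continuousWithinAt) ?_ ?_
  · rw [interior_Ioi]
    exact fun x hx => (hd x hx).differentiableWithinAt
  · rw [interior_Ioi]
    exact hf

/-- If in addition `Ψₚ′` is nonincreasing on `(0, r̃₀²]`, then for every
`0 < u ≤ r̃₀²` one has `Ψₚ(u) ≥ (p/(p−2))·(r̃₁/r̃₀)²·u·Ψₚ′(u)`. -/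
theorem psi_versus_derivative
    (p : ℕ) (hp : 3 ≤ p) (lam : ℝ) (hlam : 1 < lam)
    (r0 r1 : ℝ) (hr1 : 0 < r1) (hr01 : r1 < r0)
    (rt0 rt1 : ℝ)
    (hrt0 : rt0 = (2 / (p : ℝ)) * r0 ^ ((p : ℝ) / 2))
    (hrt1 : rt1 = (2 / (p : ℝ)) * r1 ^ ((p : ℝ) / 2))
    (Ψ : ℝ → ℝ)
    (hΨ1 : ∀ u ∈ Set.Icc (0 : ℝ) (rt1 ^ 2),
      Ψ u = ((p : ℝ) / 2) ^ ((2 * (p : ℝ) - 4) / p) * u ^ (((p : ℝ) - 2) / p))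
    (hΨ2 : ContDiffOn ℝ (⊤ : ℕ∞) Ψ (Set.Ioi 0))
    (hΨ3 : ∀ u : ℝ, 0 < u → 0 ≤ deriv Ψ u)
    (hΨ4 : ∀ u : ℝ, rt0 ^ 2 ≤ u → Ψ u = 1)
    (hmono : ∀ u v : ℝ, 0 < u → u ≤ v → v ≤ rt0 ^ 2 → deriv Ψ v ≤ deriv Ψ u) :
    ∀ u : ℝ, 0 < u → u ≤ rt0 ^ 2 →
      ((p : ℝ) / ((p : ℝ) - 2)) * (rt1 / rt0) ^ 2 * u * deriv Ψ u ≤ Ψ u := by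
  intro u hu hut
  have hp3 : (3 : ℝ) ≤ p := by exact_mod_cast hp
  have hp0 : (0 : ℝ) < p := by linarith
  have hp2 : (0 : ℝ) < (p : ℝ) - 2 := by linarith
  have h1pos : 0 < rt1 := by rw [hrt1]; positivity
  have h10 : rt1 ≤ rt0 := by
    rw [hrt0, hrt1]
    gcongr
  have h0pos : 0 < rt0 := h1pos.trans_le h10
  have hspos : 0 < rt1 ^ 2 := by positivity
  have hst : rt1 ^ 2 ≤ rt0 ^ 2 := by gcongr
  have hdiff : ∀ x : ℝ, 0 < x → DifferentiableAt ℝ Ψ x := fun x hx =>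
    (hΨ2.contDiffAt (Ioi_mem_nhds hx)).differentiableAt (by simp)
  have hmonoΨ := monotoneOn_Ioi_of_deriv_nonneg_s12 hdiff hΨ3
  have hpower : ∀ x : ℝ, 0 < x → x ≤ rt1 ^ 2 →
      (p : ℝ) / ((p : ℝ) - 2) * (x * deriv Ψ x) = Ψ x := by
    intro x hx hxs
    rw [mul_deriv_eq_of_eq_rpow_on_Icc hΨ1 hx hxs (hdiff x hx)]
    field_simp
  have hbound : ∀ x : ℝ, 0 < x → (rt1 / rt0) ^ 2 * u ≤ x → deriv Ψ u ≤ deriv Ψ x →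
      x ≤ rt1 ^ 2 → x ≤ u →
      ((p : ℝ) / ((p : ℝ) - 2)) * (rt1 / rt0) ^ 2 * u * deriv Ψ u ≤ Ψ u := by
    intro x hx hux hdx hxs hxu
    calc ((p : ℝ) / ((p : ℝ) - 2)) * (rt1 / rt0) ^ 2 * u * deriv Ψ u
        = (p : ℝ) / ((p : ℝ) - 2) * ((rt1 / rt0) ^ 2 * u * deriv Ψ u) := by ring
      _ ≤ (p : ℝ) / ((p : ℝ) - 2) * (x * deriv Ψ x) :=
          mul_le_mul_of_nonneg_left (mul_le_mul hux hdx (hΨ3 u hu) hx.le) (by positivity)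
      _ = Ψ x := hpower x hx hxs
      _ ≤ Ψ u := hmonoΨ hx hu hxu
  rcases le_total u (rt1 ^ 2) with hus | hsu
  · refine hbound u hu ?_ le_rfl hus le_rfl
    have hratio : (rt1 / rt0) ^ 2 ≤ 1 := by
      rw [div_pow]
      exact div_le_one_of_le₀ hst (by positivity)
    exact mul_le_of_le_one_left hu.le hratio
  · refine hbound (rt1 ^ 2) hspos ?_ (hmono _ _ hspos hsu hut) le_rfl hsu
    calc (rt1 / rt0) ^ 2 * u ≤ (rt1 / rt0) ^ 2 * rt0 ^ 2 := by gcongr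
      _ = rt1 ^ 2 := by field_simp
end

section
/- Let s = (s₁,s₂) : [a,b] → ℝ² be a solution of the slowdown vector field with s₁(t) > 0 and s₂(t) > 0 for all t ∈ [a,b], and let η₁, η₂ : [a,b] → ℝ be two solutions of the slope equation along s, i.e. ηᵢ′(t) = −2·(log λ)·((1+ηᵢ(t)²)·s₁(t)·s₂(t)·Ψₚ′(u(t)) + (Ψₚ(u(t)) + u(t)·Ψₚ′(u(t)))·ηᵢ(t)) where u(t) = s₁(t)²+s₂(t)², satisfying |ηᵢ(t)| < 1 for all t and i = 1,2. Then |η₁(b) − η₂(b)| ≤ |η₁(a) − η₂(a)|·(s₁(a)/s₁(b))², and since s₁·s₂ is constant along the solution this equals |η₁(a) − η₂(a)|·(s₂(b)/s₂(a))². -/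
open Real Set

/-- A function with nonpositive derivative on `[a,b]` does not increase from `a` to `b`. -/
theorem le_left_of_hasDerivWithinAt_nonpos {f f' : ℝ → ℝ} {a b : ℝ} (hab : a ≤ b)
    (hf : ∀ t ∈ Set.Icc a b, HasDerivWithinAt f (f' t) (Set.Icc a b) t)
    (hf' : ∀ t ∈ Set.Icc a b, f' t ≤ 0) : f b ≤ f a := by
  have hanti : AntitoneOn f (Set.Icc a b) :=
    antitoneOn_of_hasDerivWithinAt_nonpos (convex_Icc a b)
      (fun t ht => (hf t ht).continuousWithinAt)
      (fun t ht => (hf t (interior_subset ht)).mono interior_subset)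
      (fun t ht => hf' t (interior_subset ht))
  exact hanti (left_mem_Icc.2 hab) (right_mem_Icc.2 hab) hab

/-- If `|x|, |y| < 1`, the cross term `(x + y)·c·d` is dominated by `c² + d²`. -/
theorem sq_add_sq_add_mul_nonneg {x y c d : ℝ} (hx : |x| < 1) (hy : |y| < 1)
    (hc : 0 < c) (hd : 0 < d) : 0 ≤ c ^ 2 + d ^ 2 + (x + y) * c * d := by
  have hxy : 0 ≤ x + y + 2 := by linarith [(abs_lt.1 hx).1, (abs_lt.1 hy).1]
  have := mul_nonneg hxy (mul_pos hc hd).le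
  linarith [sq_nonneg (c - d)]

/-- Along a positive solution of the slowdown vector field on `[a,b]`, two
solutions `η₁, η₂` of the slope equation with `|ηᵢ| < 1` satisfy
`|η₁(b) − η₂(b)| ≤ |η₁(a) − η₂(a)|·(s₁(a)/s₁(b))²`, and since `s₁·s₂` is constant along
the solution this bound equals `|η₁(a) − η₂(a)|·(s₂(b)/s₂(a))²`. -/
theorem slope_contraction
    (p : ℕ) (hp : 3 ≤ p) (lam : ℝ) (hlam : 1 < lam)
    (r0 r1 : ℝ) (hr1 : 0 < r1) (hr01 : r1 < r0)
    (rt0 rt1 : ℝ)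
    (hrt0 : rt0 = (2 / (p : ℝ)) * r0 ^ ((p : ℝ) / 2))
    (hrt1 : rt1 = (2 / (p : ℝ)) * r1 ^ ((p : ℝ) / 2))
    (Ψ : ℝ → ℝ)
    (hΨ1 : ∀ u ∈ Set.Icc (0 : ℝ) (rt1 ^ 2),
      Ψ u = ((p : ℝ) / 2) ^ ((2 * (p : ℝ) - 4) / p) * u ^ (((p : ℝ) - 2) / p))
    (hΨ2 : ContDiffOn ℝ (⊤ : ℕ∞) Ψ (Set.Ioi 0))
    (hΨ3 : ∀ u : ℝ, 0 < u → 0 ≤ deriv Ψ u)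
    (hΨ4 : ∀ u : ℝ, rt0 ^ 2 ≤ u → Ψ u = 1)
    (a b : ℝ) (hab : a ≤ b) (s1 s2 : ℝ → ℝ)
    (hds1 : ∀ t ∈ Set.Icc a b, HasDerivWithinAt s1
      (Real.log lam * s1 t * Ψ (s1 t ^ 2 + s2 t ^ 2)) (Set.Icc a b) t)
    (hds2 : ∀ t ∈ Set.Icc a b, HasDerivWithinAt s2
      (-(Real.log lam * s2 t * Ψ (s1 t ^ 2 + s2 t ^ 2))) (Set.Icc a b) t)
    (hpos1 : ∀ t ∈ Set.Icc a b, 0 < s1 t)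
    (hpos2 : ∀ t ∈ Set.Icc a b, 0 < s2 t)
    (η₁ η₂ : ℝ → ℝ)
    (hdη₁ : ∀ t ∈ Set.Icc a b, HasDerivWithinAt η₁
      (-2 * Real.log lam * ((1 + η₁ t ^ 2) * s1 t * s2 t *
          deriv Ψ (s1 t ^ 2 + s2 t ^ 2) +
        (Ψ (s1 t ^ 2 + s2 t ^ 2) + (s1 t ^ 2 + s2 t ^ 2) *
          deriv Ψ (s1 t ^ 2 + s2 t ^ 2)) * η₁ t)) (Set.Icc a b) t)
    (hdη₂ : ∀ t ∈ Set.Icc a b, HasDerivWithinAt η₂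
      (-2 * Real.log lam * ((1 + η₂ t ^ 2) * s1 t * s2 t *
          deriv Ψ (s1 t ^ 2 + s2 t ^ 2) +
        (Ψ (s1 t ^ 2 + s2 t ^ 2) + (s1 t ^ 2 + s2 t ^ 2) *
          deriv Ψ (s1 t ^ 2 + s2 t ^ 2)) * η₂ t)) (Set.Icc a b) t)
    (hη₁ : ∀ t ∈ Set.Icc a b, |η₁ t| < 1)
    (hη₂ : ∀ t ∈ Set.Icc a b, |η₂ t| < 1) :
    |η₁ b - η₂ b| ≤ |η₁ a - η₂ a| * (s1 a / s1 b) ^ 2 ∧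
    |η₁ a - η₂ a| * (s1 a / s1 b) ^ 2 = |η₁ a - η₂ a| * (s2 b / s2 a) ^ 2 := by
  have hL : 0 < Real.log lam := Real.log_pos hlam
  have ha := left_mem_Icc.2 hab
  have hb := right_mem_Icc.2 hab
  have ha1 := hpos1 a ha
  have hb1 := hpos1 b hb
  have ha2 := hpos2 a ha
  have hprod : s1 b * s2 b = s1 a * s2 a := by
    have hd : ∀ t ∈ Set.Icc a b,
        HasDerivWithinAt (fun t => s1 t * s2 t) 0 (Set.Icc a b) t := fun t ht =>
      ((hds1 t ht).mul (hds2 t ht)).congr_deriv (by ring)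
    have hd' : ∀ t ∈ Set.Icc a b,
        HasDerivWithinAt (fun t => -(s1 t * s2 t)) 0 (Set.Icc a b) t := fun t ht =>
      (hd t ht).neg.congr_deriv neg_zero
    have h1 := le_left_of_hasDerivWithinAt_nonpos hab hd (fun _ _ => le_rfl)
    have h2 := le_left_of_hasDerivWithinAt_nonpos hab hd' (fun _ _ => le_rfl)
    exact le_antisymm h1 (neg_le_neg_iff.1 h2)
  refine ⟨?_, ?_⟩
  · have hsq : ((η₁ b - η₂ b) * s1 b ^ 2) ^ 2 ≤ ((η₁ a - η₂ a) * s1 a ^ 2) ^ 2 := by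
      refine le_left_of_hasDerivWithinAt_nonpos
        (f := fun t => ((η₁ t - η₂ t) * s1 t ^ 2) ^ 2)
        (f' := fun t => -(4 * Real.log lam * deriv Ψ (s1 t ^ 2 + s2 t ^ 2) *
          (s1 t ^ 2 + s2 t ^ 2 + (η₁ t + η₂ t) * s1 t * s2 t) *
          ((η₁ t - η₂ t) * s1 t ^ 2) ^ 2)) hab (fun t ht => ?_) (fun t ht => ?_)
      · refine ((((hdη₁ t ht).sub (hdη₂ t ht)).mul ((hds1 t ht).pow 2)).pow 2).congr_deriv ?_
        simp only [Pi.mul_apply, Pi.sub_apply, Pi.pow_apply]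
        push_cast
        ring
      · have hpos := hpos1 t ht
        have hΨ := hΨ3 (s1 t ^ 2 + s2 t ^ 2) (by positivity)
        have hcross := sq_add_sq_add_mul_nonneg (hη₁ t ht) (hη₂ t ht) hpos (hpos2 t ht)
        exact neg_nonpos.2 (by positivity)
    have habs := sq_le_sq.1 hsq
    rw [abs_mul, abs_mul, abs_of_pos (pow_pos hb1 2), abs_of_pos (pow_pos ha1 2)] at habs
    rwa [div_pow, ← mul_div_assoc, le_div_iff₀ (pow_pos hb1 2)]
  · have hratio : s1 a / s1 b = s2 b / s2 a := by
      rw [div_eq_div_iff hb1.ne' ha2.ne']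
      linarith
    rw [hratio]
end
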